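/- arXiv:2106.00836 — 4 statements merged into one kernel-verified Lean document; each statement's English description precedes it below -/
import Mathlib

section
/- Let φ denote Euler's totient function and ⌊·⌋ the floor function. Then lim_{x→∞} 2·Σ_{c=1}^{⌊x⌋} (φ(c)/c)·(√(x²−c²)/x²) = 3/π, where the limit is taken as the real variable x tends to +∞. -/
open Filter

open Finset in
/-- The identity `φ(n) / n = ∑_{d ∣ n} μ(d) / d`, over factorizations of `n`. -/
theorem totient_div_eq_sum_moebius_div {n : ℕ} (hn : 0 < n) :
    (Nat.totient n : ℝ) / n =
      ∑ p ∈ n.divisorsAntidiagonal, (ArithmeticFunction.moebius p.1 : ℝ) / p.1 := by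
  have h := (ArithmeticFunction.sum_eq_iff_sum_mul_moebius_eq (R := ℝ)
    (f := fun k => (Nat.totient k : ℝ)) (g := fun k => (k : ℝ))).1
    (fun m _ => by exact_mod_cast Nat.sum_totient m) n hn
  rw [← h, sum_div]
  refine sum_congr rfl fun p hp => ?_
  obtain ⟨hp, -⟩ := Nat.mem_divisorsAntidiagonal.1 hp
  subst hp
  have h1 : (p.1 : ℝ) ≠ 0 := by
    have := Nat.pos_of_mul_pos_right hn
    positivity
  have h2 : (p.2 : ℝ) ≠ 0 := by
    have := Nat.pos_of_mul_pos_left hn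
    positivity
  push_cast
  field_simp

theorem hasSum_moebius_div_sq :
    HasSum (fun d : ℕ => (ArithmeticFunction.moebius d : ℝ) / (d : ℝ) ^ 2)
      (6 / Real.pi ^ 2) := by
  have hs : (1 : ℝ) < (2 : ℂ).re := by norm_num
  have hsum := (ArithmeticFunction.LSeriesSummable_moebius_iff.2 hs).hasSum
  have hval : LSeries (fun n => ((ArithmeticFunction.moebius n : ℤ) : ℂ)) 2
      = ((6 / Real.pi ^ 2 : ℝ) : ℂ) := by
    have h := ArithmeticFunction.LSeries_zeta_mul_Lseries_moebius hs
    rw [ArithmeticFunction.LSeries_zeta_eq_riemannZeta hs, riemannZeta_two] at h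
    have hpi : (Real.pi : ℂ) ≠ 0 := by exact_mod_cast Real.pi_ne_zero
    push_cast
    field_simp at h ⊢
    linear_combination h
  change HasSum _ (LSeries _ 2) at hsum
  rw [hval] at hsum
  rw [← Complex.hasSum_ofReal]
  convert! hsum using 2 with d
  rw [LSeries.term_def₀ (by simp), Complex.cpow_neg, Complex.cpow_ofNat]
  push_cast
  rw [div_eq_mul_inv]

theorem integral_sqrt_one_sub_sq_zero_one :
    ∫ t in (0 : ℝ)..1, √(1 - t ^ 2) = Real.pi / 4 := by
  have hc : Continuous fun t : ℝ => √(1 - t ^ 2) := by fun_prop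
  have h := integral_sqrt_one_sub_sq
  rw [← intervalIntegral.integral_add_adjacent_intervals
    (hc.intervalIntegrable (-1) 0) (hc.intervalIntegrable 0 1)] at h
  have h' := intervalIntegral.integral_comp_neg (a := 0) (b := 1) fun t : ℝ => √(1 - t ^ 2)
  simp only [neg_sq, neg_zero] at h'
  linarith

/-- The right-endpoint sum of `t ↦ √(1 - (t / y)²)` over the positive integers up to `y`. -/
noncomputable def quarterCircleSum (y : ℝ) : ℝ :=
  ∑ m ∈ Finset.Icc 1 ⌊y⌋₊, √(1 - (m / y) ^ 2)

theorem sum_Icc_sqrt_eq_quarterCircleSum {y : ℝ} (hy : 0 < y) {N : ℕ} (hN : ⌊y⌋₊ ≤ N) :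
    ∑ m ∈ Finset.Icc 1 N, √(1 - (m / y) ^ 2) = quarterCircleSum y := by
  refine (Finset.sum_subset (Finset.Icc_subset_Icc_right hN) fun m hm hm' => ?_).symm
  have hlt : y < m := by
    rw [← Nat.floor_lt hy.le]
    simp only [Finset.mem_Icc] at hm hm'
    omega
  have : 1 ≤ m / y := (one_le_div hy).2 hlt.le
  exact Real.sqrt_eq_zero_of_nonpos (by nlinarith)

theorem quarterCircleSum_nonneg (y : ℝ) : 0 ≤ quarterCircleSum y :=
  Finset.sum_nonneg fun _ _ => Real.sqrt_nonneg _

theorem quarterCircleSum_le {y : ℝ} (hy : 0 ≤ y) : quarterCircleSum y ≤ y := by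
  calc quarterCircleSum y ≤ ∑ m ∈ Finset.Icc 1 ⌊y⌋₊, (1 : ℝ) :=
        Finset.sum_le_sum fun m _ => Real.sqrt_le_one.2 (by nlinarith [sq_nonneg (m / y)])
    _ = ⌊y⌋₊ := by simp
    _ ≤ y := Nat.floor_le hy

theorem abs_quarterCircleSum_sub_le {y : ℝ} (hy : 0 < y) :
    |quarterCircleSum y - Real.pi / 4 * y| ≤ 1 := by
  set f : ℝ → ℝ := fun t => √(1 - (t / y) ^ 2) with hf
  have hc : Continuous f := by fun_prop
  have hanti : AntitoneOn f (Set.Ici 0) := fun a ha b _ hab => by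
    have ha' : 0 ≤ a := ha
    simp only [hf]
    gcongr
  have hint : ∫ t in (0 : ℝ)..y, f t = Real.pi / 4 * y := by
    have h := intervalIntegral.integral_comp_div (a := 0) (b := y)
      (fun t : ℝ => √(1 - t ^ 2)) hy.ne'
    rw [zero_div, div_self hy.ne', integral_sqrt_one_sub_sq_zero_one, smul_eq_mul] at h
    rw [hf, h, mul_comm]
  have hS : quarterCircleSum y = ∑ i ∈ Finset.range ⌊y⌋₊, f (0 + (i + 1 : ℕ)) := by
    rw [quarterCircleSum, Finset.range_eq_Ico, Finset.sum_Ico_add' (fun i : ℕ => f (0 + i)) 0 _ 1]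
    simp [hf, Finset.Ico_add_one_right_eq_Icc]
  have hmono {a b : ℝ} (hab : a ≤ b) : ∫ t in (0 : ℝ)..a, f t ≤ ∫ t in (0 : ℝ)..b, f t := by
    rw [← sub_nonneg, intervalIntegral.integral_interval_sub_left
      (hc.intervalIntegrable _ _) (hc.intervalIntegrable _ _)]
    exact intervalIntegral.integral_nonneg hab fun t _ => Real.sqrt_nonneg _
  have hup : quarterCircleSum y ≤ Real.pi / 4 * y := by
    rw [hS, ← hint]
    refine (AntitoneOn.sum_le_integral (hanti.mono Set.Icc_subset_Ici_self)).trans ?_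
    rw [zero_add]
    exact hmono (Nat.floor_le hy.le)
  have hlow : Real.pi / 4 * y ≤ quarterCircleSum y + 1 := by
    have h := AntitoneOn.integral_le_sum (f := f) (x₀ := 0) (a := ⌊y⌋₊ + 1)
      (hanti.mono Set.Icc_subset_Ici_self)
    rw [Finset.sum_range_succ', ← hS, zero_add] at h
    have h0 : f (0 + ((0 : ℕ) : ℝ)) = 1 := by simp [hf]
    rw [h0] at h
    rw [← hint]
    refine (hmono ?_).trans h
    push_cast
    exact (Nat.lt_floor_add_one y).le
  rw [abs_le]
  constructor <;> linarith

theorem tendsto_quarterCircleSum_div :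
    Tendsto (fun y => quarterCircleSum y / y) atTop (nhds (Real.pi / 4)) := by
  rw [tendsto_iff_dist_tendsto_zero]
  refine squeeze_zero' (Eventually.of_forall fun _ => dist_nonneg) ?_ tendsto_inv_atTop_zero
  filter_upwards [eventually_gt_atTop 0] with y hy
  have h : quarterCircleSum y / y - Real.pi / 4
      = (quarterCircleSum y - Real.pi / 4 * y) / y := by field_simp
  rw [Real.dist_eq, h, abs_div, abs_of_pos hy, inv_eq_one_div]
  gcongr
  exact abs_quarterCircleSum_sub_le hy

open Finset in
theorem sum_totient_mul_sqrt_eq_tsum {x : ℝ} (hx : 0 < x) :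
    ∑ c ∈ Icc 1 ⌊x⌋₊, ((Nat.totient c : ℝ) / c) * (√(x ^ 2 - (c : ℝ) ^ 2) / x ^ 2) =
      ∑' d : ℕ, (ArithmeticFunction.moebius d : ℝ) / (d : ℝ) ^ 2 *
        (quarterCircleSum (x / d) / (x / d)) := by
  set N := ⌊x⌋₊
  have hzero : ∀ d ∉ Icc 1 N, (ArithmeticFunction.moebius d : ℝ) / (d : ℝ) ^ 2 *
      (quarterCircleSum (x / d) / (x / d)) = 0 := fun d hd => by
    rcases Nat.eq_zero_or_pos d with rfl | hd0
    · simp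
    · have hd1 : x < d := by
        rw [← Nat.floor_lt hx.le]
        simp only [mem_Icc] at hd
        omega
      have : ⌊x / d⌋₊ = 0 := Nat.floor_eq_zero.2 ((div_lt_one (by positivity)).2 hd1)
      simp [quarterCircleSum, this]
  rw [tsum_eq_sum hzero]
  have hterm : ∀ c ∈ Icc 1 N,
      ((Nat.totient c : ℝ) / c) * (√(x ^ 2 - (c : ℝ) ^ 2) / x ^ 2) =
        ∑ p ∈ Icc 1 N ×ˢ Icc 1 N with p.1 * p.2 = c,
          (ArithmeticFunction.moebius p.1 : ℝ) / p.1 *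
            (√(1 - (((p.1 * p.2 : ℕ) : ℝ) / x) ^ 2) / x) := fun c hc => by
    rw [mem_Icc] at hc
    have hsq : √(x ^ 2 - (c : ℝ) ^ 2) / x ^ 2 = √(1 - ((c : ℝ) / x) ^ 2) / x := by
      have : x ^ 2 - (c : ℝ) ^ 2 = x ^ 2 * (1 - ((c : ℝ) / x) ^ 2) := by field_simp
      rw [this, Real.sqrt_mul (sq_nonneg x), Real.sqrt_sq hx.le]
      field_simp
    rw [totient_div_eq_sum_moebius_div hc.1, hsq, sum_mul,
      Nat.divisorsAntidiagonal_eq_prod_filter_of_le (by omega) hc.2]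
    refine sum_congr rfl fun p hp => ?_
    rw [(mem_filter.1 hp).2]
  have hbig : ∀ p ∈ Icc 1 N ×ˢ Icc 1 N, p.1 * p.2 ∉ Icc 1 N →
      (ArithmeticFunction.moebius p.1 : ℝ) / p.1 *
        (√(1 - (((p.1 * p.2 : ℕ) : ℝ) / x) ^ 2) / x) = 0 := fun p hp hpN => by
    simp only [mem_product, mem_Icc] at hp hpN
    have hpos : 1 ≤ p.1 * p.2 := Nat.mul_pos hp.1.1 hp.2.1
    have hlt : x < (p.1 * p.2 : ℕ) := by
      rw [← Nat.floor_lt hx.le]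
      change N < _
      omega
    have h1 : 1 ≤ ((p.1 * p.2 : ℕ) : ℝ) / x := (one_le_div hx).2 hlt.le
    rw [Real.sqrt_eq_zero_of_nonpos (by nlinarith), zero_div, mul_zero]
  rw [sum_congr rfl hterm, sum_fiberwise_eq_sum_filter, sum_filter_of_ne, sum_product]
  · refine sum_congr rfl fun d hd => ?_
    have hd0 : (0 : ℝ) < d := by exact_mod_cast (mem_Icc.1 hd).1
    have hle : ⌊x / d⌋₊ ≤ N :=
      Nat.floor_mono (div_le_self hx.le (by exact_mod_cast (mem_Icc.1 hd).1))
    rw [← sum_Icc_sqrt_eq_quarterCircleSum (div_pos hx hd0) hle]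
    have : ∀ m : ℕ, ((d * m : ℕ) : ℝ) / x = m / (x / d) := fun m => by
      push_cast
      field_simp
    simp only [this]
    rw [← mul_sum, ← sum_div]
    field_simp
  · intro p hp hne
    by_contra hpN
    exact hne (hbig p hp hpN)

/-- Let φ denote Euler's totient function and ⌊·⌋ the floor function. Then
`lim_{x→∞} 2·Σ_{c=1}^{⌊x⌋} (φ(c)/c)·(√(x²−c²)/x²) = 3/π`. -/
theorem stmt_0 :
    Tendsto (fun x : ℝ => 2 * ∑ c ∈ Finset.Icc 1 ⌊x⌋₊,
        ((Nat.totient c : ℝ) / c) * (Real.sqrt (x ^ 2 - (c : ℝ) ^ 2) / x ^ 2))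
      atTop (nhds (3 / Real.pi)) := by
  have hlim : Tendsto (fun x : ℝ => ∑' d : ℕ,
      (ArithmeticFunction.moebius d : ℝ) / (d : ℝ) ^ 2 * (quarterCircleSum (x / d) / (x / d)))
      atTop (nhds (∑' d : ℕ,
        (ArithmeticFunction.moebius d : ℝ) / (d : ℝ) ^ 2 * (Real.pi / 4))) := by
    refine tendsto_tsum_of_dominated_convergence hasSum_moebius_div_sq.summable.norm
      (fun d => ?_) ?_
    · rcases Nat.eq_zero_or_pos d with rfl | hd
      · simp
      · exact (tendsto_quarterCircleSum_div.comp
          (tendsto_id.atTop_div_const (by positivity))).const_mul _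
    · filter_upwards [eventually_ge_atTop 0] with x hx d
      rw [norm_mul]
      refine mul_le_of_le_one_right (norm_nonneg _) ?_
      have hxd : 0 ≤ x / d := by positivity
      rw [Real.norm_of_nonneg (div_nonneg (quarterCircleSum_nonneg _) hxd)]
      exact div_le_one_of_le₀ (quarterCircleSum_le hxd) hxd
  rw [tsum_mul_right, hasSum_moebius_div_sq.tsum_eq] at hlim
  have hval : 3 / Real.pi = 2 * (6 / Real.pi ^ 2 * (Real.pi / 4)) := by
    have := Real.pi_ne_zero
    field_simp
    norm_num
  rw [hval]
  refine (hlim.const_mul 2).congr' ?_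
  filter_upwards [eventually_gt_atTop 0] with x hx
  rw [sum_totient_mul_sqrt_eq_tsum hx]
end

section
/- For T > 0 set y := 1/(4T) and S(T) := ∫₀¹ ( 1_{[T,∞)}(y) + Σ_{c=1}^∞ Σ_{d∈ℤ, gcd(c,d)=1} 1_{[T,∞)}( y/((cx+d)² + c²y²) ) ) dx. Then T·S(T) → √3/2 as T → ∞. -/
open Filter MeasureTheory

lemma le_div_sq_add_sq_iff {T c u : ℝ} (hT : 0 < T) (hc : 1 ≤ c) :
    T ≤ (1 / (4 * T)) / (u ^ 2 + c ^ 2 * (1 / (4 * T)) ^ 2) ↔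
      u ^ 2 ≤ (4 - c ^ 2) * (1 / (4 * T)) ^ 2 := by
  have hy : 0 < 1 / (4 * T) := by positivity
  have hTy : T * (1 / (4 * T)) = 1 / 4 := by field_simp
  generalize 1 / (4 * T) = y at hy hTy ⊢
  rw [le_div_iff₀ (by positivity)]
  have key : T * (4 * y ^ 2) = y := by linear_combination 4 * y * hTy
  constructor
  · intro h
    have := le_of_mul_le_mul_left (h.trans key.ge) hT
    linarith
  · intro h
    calc T * (u ^ 2 + c ^ 2 * y ^ 2) ≤ T * (4 * y ^ 2) := by gcongr; linarith
      _ = y := key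

lemma antitone_ite_le (a : ℝ) : Antitone (fun x : ℝ => if x ≤ a then (1 : ℝ) else 0) := by
  intro x z hxz
  dsimp only
  split_ifs with h₁ h₂
  · exact le_rfl
  · exact absurd (hxz.trans h₁) h₂
  · exact zero_le_one
  · exact le_rfl

lemma integral_ite_le {a : ℝ} (h₀ : 0 ≤ a) (h₁ : a ≤ 1) :
    ∫ x in (0 : ℝ)..1, (if x ≤ a then (1 : ℝ) else 0) = a := by
  have := intervalIntegral.integral_indicator (μ := volume) (f := fun _ : ℝ => (1 : ℝ))
    (show a ∈ Set.Icc (0 : ℝ) 1 from ⟨h₀, h₁⟩)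
  simpa [Set.indicator_apply] using this

lemma integral_ite_le_add_ite_one_sub_le {a : ℝ} (h₀ : 0 ≤ a) (h₁ : a ≤ 1) :
    ∫ x in (0 : ℝ)..1, ((if x ≤ a then (1 : ℝ) else 0) + (if 1 - x ≤ a then (1 : ℝ) else 0))
      = 2 * a := by
  have h := integral_ite_le h₀ h₁
  have h' : ∫ x in (0 : ℝ)..1, (if 1 - x ≤ a then (1 : ℝ) else 0) = a := by
    simpa [h] using intervalIntegral.integral_comp_sub_left (a := 0) (b := 1)
      (fun x : ℝ => if x ≤ a then (1 : ℝ) else 0) 1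
  have hm : Monotone (fun x : ℝ => if 1 - x ≤ a then (1 : ℝ) else 0) :=
    fun x z hxz => antitone_ite_le a (sub_le_sub_left hxz 1)
  rw [intervalIntegral.integral_add (antitone_ite_le a).intervalIntegrable hm.intervalIntegrable,
    h, h', two_mul]

/-- Away from `x = 1/2`, only the pairs `(1, 0)` and `(1, -1)` contribute on `(0, 1)`. -/
lemma tsum_tsum_eq_ite_add_ite {T x : ℝ} (hT : 1 ≤ T) (hx₀ : 0 < x) (hx₁ : x < 1)
    (hx : x ≠ 1 / 2) :
    (∑' c : ℕ, ∑' d : ℤ,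
      if 1 ≤ c ∧ Int.gcd (c : ℤ) d = 1 then
        (if T ≤ (1 / (4 * T)) /
            (((c : ℝ) * x + (d : ℝ)) ^ 2 + (c : ℝ) ^ 2 * (1 / (4 * T)) ^ 2)
          then (1:ℝ) else 0)
      else 0) =
      (if x ≤ √3 * (1 / (4 * T)) then (1 : ℝ) else 0) +
        (if 1 - x ≤ √3 * (1 / (4 * T)) then (1 : ℝ) else 0) := by
  have hT₀ : 0 < T := by linarith
  have hy : 0 < 1 / (4 * T) := by positivity
  have hy₁ : 1 / (4 * T) ≤ 1 / 4 := by gcongr; linarith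
  have hiff (c : ℕ) (d : ℤ) (hc : 1 ≤ c) :=
    le_div_sq_add_sq_iff (u := (c : ℝ) * x + d) hT₀ (show (1 : ℝ) ≤ c by exact_mod_cast hc)
  generalize 1 / (4 * T) = y at *
  have h3 : √3 ^ 2 = 3 := Real.sq_sqrt (by norm_num)
  have ha : 0 ≤ √3 * y := by positivity
  have hsq {u : ℝ} : u ^ 2 ≤ (4 - ((1 : ℕ) : ℝ) ^ 2) * y ^ 2 ↔ |u| ≤ √3 * y := by
    rw [← abs_of_nonneg ha, ← sq_le_sq, mul_pow, h3]
    norm_num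
  rw [tsum_eq_single 1, tsum_eq_sum (s := {0, -1})]
  · rw [Finset.sum_pair (by norm_num)]
    simp only [hiff 1 _ le_rfl, hsq]
    have e₁ : |((1 : ℕ) : ℝ) * x + ((0 : ℤ) : ℝ)| = x := by simp [abs_of_pos hx₀]
    have e₂ : |((1 : ℕ) : ℝ) * x + ((-1 : ℤ) : ℝ)| = 1 - x := by
      rw [abs_of_neg] <;> push_cast <;> linarith
    rw [e₁, e₂]
    simp
  · intro d hd
    simp only [Finset.mem_insert, Finset.mem_singleton, not_or] at hd
    refine ite_eq_right_iff.2 fun _ => if_neg ?_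
    rw [hiff 1 _ le_rfl, not_le]
    have h1 : 1 < (((1 : ℕ) : ℝ) * x + d) ^ 2 := by
      rw [one_lt_sq_iff_one_lt_abs, lt_abs]
      rcases lt_or_ge d 0 with h | h
      · right
        have : (d : ℝ) ≤ -2 := by exact_mod_cast (by omega : d ≤ -2)
        push_cast; linarith
      · left
        have : (1 : ℝ) ≤ d := by exact_mod_cast (by omega : 1 ≤ d)
        push_cast; linarith
    push_cast at h1 ⊢
    nlinarith
  · intro c hc
    refine (tsum_congr fun d => ?_).trans tsum_zero
    refine ite_eq_right_iff.2 fun ⟨hc₁, hcd⟩ => if_neg ?_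
    rw [hiff c d hc₁, not_le]
    rcases (show c = 2 ∨ 3 ≤ c by omega) with rfl | hc₃
    · have hne : ((2 : ℕ) : ℝ) * x + d ≠ 0 := by
        intro h
        push_cast at h
        have h₁ : (-2 : ℝ) < d := by linarith
        have h₂ : (d : ℝ) < 0 := by linarith
        have h₁' : -2 < d := by exact_mod_cast h₁
        have h₂' : d < 0 := by exact_mod_cast h₂
        obtain rfl : d = -1 := by omega
        push_cast at h
        exact hx (by linarith)
      have := pow_pos (abs_pos.2 hne) 2
      rw [sq_abs] at this
      norm_num at this ⊢
      exact this
    · have : (3 : ℝ) ≤ c := by exact_mod_cast hc₃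
      have h₁ : (4 - (c : ℝ) ^ 2) * y ^ 2 < 0 :=
        mul_neg_of_neg_of_pos (by nlinarith) (by positivity)
      exact h₁.trans_le (sq_nonneg _)

/-- For `T > 0` set `y := 1/(4T)` and
`S(T) := ∫₀¹ ( 1_{[T,∞)}(y) + Σ_{c≥1} Σ_{d∈ℤ, gcd(c,d)=1} 1_{[T,∞)}( y/((cx+d)² + c²y²) ) ) dx`.
Then `T·S(T) → √3/2` as `T → ∞`. -/
theorem stmt_1 :
    Tendsto (fun T : ℝ =>
        T * ∫ x in (0:ℝ)..1,
          ((if T ≤ 1 / (4 * T) then (1:ℝ) else 0) +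
            ∑' c : ℕ, ∑' d : ℤ,
              if 1 ≤ c ∧ Int.gcd (c : ℤ) d = 1 then
                (if T ≤ (1 / (4 * T)) /
                    (((c : ℝ) * x + (d : ℝ)) ^ 2 + (c : ℝ) ^ 2 * (1 / (4 * T)) ^ 2)
                  then (1:ℝ) else 0)
              else 0))
      atTop (nhds (Real.sqrt 3 / 2)) := by
  refine tendsto_const_nhds.congr' ?_
  filter_upwards [eventually_ge_atTop 1] with T hT
  have hT₀ : 0 < T := by linarith
  have hy₁ : 1 / (4 * T) ≤ 1 / 4 := by gcongr; linarith
  have hs : √3 ≤ 2 := Real.sqrt_le_iff.2 (by norm_num)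
  have ha : √3 * (1 / (4 * T)) ≤ 1 := by
    calc √3 * (1 / (4 * T)) ≤ 2 * (1 / 4) := by gcongr
      _ ≤ 1 := by norm_num
  rw [intervalIntegral.integral_congr_ae
    (g := fun x => (if x ≤ √3 * (1 / (4 * T)) then (1 : ℝ) else 0) +
      (if 1 - x ≤ √3 * (1 / (4 * T)) then (1 : ℝ) else 0)),
    integral_ite_le_add_ite_one_sub_le (by positivity) ha]
  · field_simp
    norm_num
  · filter_upwards [Measure.ae_ne volume (1 / 2 : ℝ), Measure.ae_ne volume (1 : ℝ)]
      with x hx hx₁ hmem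
    rw [Set.uIoc_of_le zero_le_one] at hmem
    rw [if_neg (by linarith), zero_add,
      tsum_tsum_eq_ite_add_ite hT hmem.1 (lt_of_le_of_ne hmem.2 hx₁) hx]
end

section
/- Let f be as in the context, with automorphic lift Φ_f, let y > 0 and m ∈ ℤ. Then ∫₀¹ Φ_f(x+iy, 0)·e(mx) dx = ∫₀¹ f(x+iy, 0)·e(mx) dx + y·Σ_{c=1}^∞ Σ_{d∈{1,…,c}, gcd(d,c)=1} ∫_{−∞}^{∞} f( a/c − (1/(c²y))·(1/(x+i)), −2·arg(x+i) )·e(mxy − m·d/c) dx, where for each such pair (c,d), a is any integer with a·d ≡ 1 (mod c) (the integrand is independent of this choice by the periodicity of f). All sums have only finitely many nonzero terms and all integrands are bounded with compact support, since f vanishes for imaginary part below B. -/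
open MeasureTheory

/-- `e(w) := exp(2πiw)`. -/
noncomputable def e (w : ℂ) : ℂ := Complex.exp (2 * Real.pi * Complex.I * w)

/-- The automorphic lift over `PSL(2,ℤ)` at the standard cusp `∞` of a bounded Borel
function `f` on `ℍ × ℝ` that is `1`-periodic in `Re z` and `2π`-periodic in `θ` and
vanishes for small `Im z`.  For each coprime pair `(c,d)` with `c ≥ 1`, `a c d` and
`b c d` are a choice of integers with `a·d − b·c = 1`; the summand is independent
of this choice by the periodicity of `f`. -/
noncomputable def lift (a b : ℕ → ℤ → ℤ) (f : ℂ → ℝ → ℂ) (z : ℂ) (θ : ℝ) : ℂ :=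
  f z θ + ∑' c : ℕ, ∑' d : ℤ,
    if 1 ≤ c ∧ Int.gcd (c : ℤ) d = 1 then
      f (((a c d : ℂ) * z + (b c d : ℂ)) / ((c : ℂ) * z + (d : ℂ)))
        (θ - 2 * Complex.arg ((c : ℂ) * z + (d : ℂ)))
    else 0

/-- The summand of the automorphic lift attached to `(c, d)`, in terms of an inverse `r` of `d`
modulo `c`, as a function of the real part of the point. -/
noncomputable def cosetTerm (f : ℂ → ℝ → ℂ) (y : ℝ) (c : ℕ) (d r : ℤ) (x : ℝ) : ℂ :=
  f ((r : ℂ) / c - 1 / (c * (c * (x + y * Complex.I) + d)))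
    (-2 * Complex.arg (c * (x + y * Complex.I) + d))

lemma e_add (v w : ℂ) : e (v + w) = e v * e w := by
  simp only [e, mul_add, Complex.exp_add]

lemma e_intCast (n : ℤ) : e n = 1 := by
  rw [e, ← Complex.exp_int_mul_two_pi_mul_I n]
  ring_nf

lemma norm_e_ofReal (t : ℝ) : ‖e t‖ = 1 := by
  rw [e, ← Complex.norm_exp_ofReal_mul_I (2 * Real.pi * t)]
  push_cast
  ring_nf

lemma norm_e_intCast_mul_ofReal (m : ℤ) (x : ℝ) : ‖e (m * x)‖ = 1 := by
  rw [← norm_e_ofReal (m * x)]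
  push_cast
  rfl

lemma measurable_e_intCast_mul_ofReal (m : ℤ) : Measurable fun x : ℝ => e (m * x) := by
  unfold e
  fun_prop

lemma intervalIntegrable_fun_sum {ι : Type*} {μ : Measure ℝ} {a b : ℝ} (s : Finset ι)
    {g : ι → ℝ → ℂ} (h : ∀ i ∈ s, IntervalIntegrable (g i) μ a b) :
    IntervalIntegrable (fun x => ∑ i ∈ s, g i x) μ a b := by
  simpa only [Finset.sum_fn] using IntervalIntegrable.sum s h

lemma mul_add_ne_zero {y : ℝ} (hy : 0 < y) {c : ℕ} (hc : 1 ≤ c) (d : ℤ) (x : ℝ) :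
    (c : ℂ) * (x + y * Complex.I) + d ≠ 0 := by
  intro h
  have h' := congrArg Complex.im h
  have hc' : (0 : ℝ) < c := by exact_mod_cast hc
  simp at h'
  rcases h' with h' | h'
  · omega
  · exact hy.ne' h'

section

variable {f : ℂ → ℝ → ℂ} {y : ℝ}

lemma measurable_cosetTerm (hmeas : Measurable (Function.uncurry f)) (c : ℕ) (d r : ℤ) :
    Measurable (cosetTerm f y c d r) := by
  have h : Measurable fun x : ℝ =>
      (((r : ℂ) / c - 1 / (c * (c * (x + y * Complex.I) + d)),
        -2 * Complex.arg (c * (x + y * Complex.I) + d)) : ℂ × ℝ) := by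
    refine Measurable.prodMk (by fun_prop) ?_
    exact (Complex.measurable_arg.comp (by fun_prop)).const_mul _
  exact hmeas.comp h

lemma cosetTerm_eq_zero {B : ℝ} (hB : 1 < B) (hvan : ∀ z θ, z.im < B → f z θ = 0)
    {c : ℕ} (hc : 1 ≤ c) (d r : ℤ) {x : ℝ} (hy : 0 < y)
    (h : y < (c * x + d) ^ 2 + (c * y) ^ 2) : cosetTerm f y c d r x = 0 := by
  apply hvan
  refine lt_trans ?_ hB
  have hc' : (0 : ℝ) < c := by exact_mod_cast hc
  have h1 : ((r : ℂ) / c).im = 0 := by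
    have : (r : ℂ) / c = ((r / c : ℝ) : ℂ) := by push_cast; rfl
    rw [this, Complex.ofReal_im]
  have hpos : 0 < (c * x + d) ^ 2 + (c * y) ^ 2 := hy.trans h
  have h2 : (1 / ((c : ℂ) * (c * (x + y * Complex.I) + d))).im
      = -(y / ((c * x + d) ^ 2 + (c * y) ^ 2)) := by
    have hw : (c : ℂ) * (c * (x + y * Complex.I) + d)
        = ((c * (c * x + d) : ℝ) : ℂ) + ((c * (c * y) : ℝ) : ℂ) * Complex.I := by
      push_cast
      ring
    rw [one_div, hw, Complex.inv_im, Complex.normSq_add_mul_I]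
    simp only [Complex.add_im, Complex.ofReal_im, Complex.mul_im, Complex.ofReal_re,
      Complex.I_im, Complex.I_re]
    have h3 : (c * (c * x + d)) ^ 2 + (c * (c * y)) ^ 2
        = (c : ℝ) ^ 2 * ((c * x + d) ^ 2 + (c * y) ^ 2) := by ring
    rw [h3]
    field_simp
    ring
  rw [Complex.sub_im, h1, h2, zero_sub, neg_neg, div_lt_one hpos]
  exact h

lemma cosetTerm_congr (hper : ∀ z θ, f (z + 1) θ = f z θ) {c : ℕ} (hc : 1 ≤ c) (d : ℤ)
    {r s : ℤ} (h : r ≡ s [ZMOD c]) (x : ℝ) : cosetTerm f y c d r x = cosetTerm f y c d s x := by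
  obtain ⟨k, hk⟩ := h.dvd
  have hc' : (c : ℂ) ≠ 0 := by exact_mod_cast (by omega : c ≠ 0)
  have hs : (s : ℂ) / c = r / c + k := by
    have : s = r + c * k := by linarith
    rw [this]
    push_cast
    field_simp
  have hp : ∀ θ, Function.Periodic (fun z => f z θ) (k * 1) := fun θ =>
    Function.Periodic.int_mul (fun z => hper z θ) k
  unfold cosetTerm
  rw [hs]
  refine (hp (-2 * Complex.arg (c * (x + y * Complex.I) + d)) ((r : ℂ) / c - 1 / (c * (c * (x + y * Complex.I) + d)))).symm.trans ?_
  congr 1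
  ring

lemma cosetTerm_add_mul (c : ℕ) (d r k : ℤ) (x : ℝ) :
    cosetTerm f y c (k * c + d) r x = cosetTerm f y c d r (x + k) := by
  have h : (c : ℂ) * (x + y * Complex.I) + ((k * c + d : ℤ) : ℂ)
      = c * (((x + k : ℝ) : ℂ) + y * Complex.I) + d := by
    push_cast
    ring
  unfold cosetTerm
  rw [h]

lemma apply_moebius_eq_cosetTerm (hy : 0 < y) {c : ℕ} (hc : 1 ≤ c) {r s d : ℤ}
    (hdet : r * d - s * c = 1) (x : ℝ) :
    f (((r : ℂ) * (x + y * Complex.I) + s) / (c * (x + y * Complex.I) + d))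
      (0 - 2 * Complex.arg (c * (x + y * Complex.I) + d)) = cosetTerm f y c d r x := by
  have hc' : (c : ℂ) ≠ 0 := by exact_mod_cast (by omega : c ≠ 0)
  have hw := mul_add_ne_zero hy hc d x
  have hdet' : (r : ℂ) * d - s * c = 1 := by exact_mod_cast hdet
  unfold cosetTerm
  congr 1
  · set z : ℂ := x + y * Complex.I
    rw [← hdet', div_sub_div _ _ hc' (mul_ne_zero hc' hw), div_eq_div_iff hw
      (mul_ne_zero hc' (mul_ne_zero hc' hw))]
    ring
  · ring

lemma integrable_cosetTerm_mul_e {B M : ℝ} (hB : 1 < B) (hvan : ∀ z θ, z.im < B → f z θ = 0)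
    (hmeas : Measurable (Function.uncurry f)) (hbdd : ∀ z θ, ‖f z θ‖ ≤ M) (hy : 0 < y)
    {c : ℕ} (hc : 1 ≤ c) (d r m : ℤ) :
    Integrable fun x : ℝ => cosetTerm f y c d r x * e (m * x) := by
  have hc' : (1 : ℝ) ≤ c := by exact_mod_cast hc
  have hsupp : Function.support (fun x : ℝ => cosetTerm f y c d r x * e (m * x))
      ⊆ Set.Icc (-(|(d : ℝ)| + y + 1)) (|(d : ℝ)| + y + 1) := by
    intro x hx
    by_contra hx'
    apply hx
    have : cosetTerm f y c d r x = 0 := by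
      apply cosetTerm_eq_zero hB hvan hc d r hy
      have hd1 := le_abs_self (d : ℝ)
      have hd2 := neg_abs_le (d : ℝ)
      have hd3 := abs_nonneg (d : ℝ)
      have : y < (c * x + d) ^ 2 := by
        rw [Set.mem_Icc, not_and_or, not_le, not_le] at hx'
        rcases hx' with hx' | hx'
        · have : c * x + d < -(y + 1) := by nlinarith
          nlinarith
        · have : y + 1 < c * x + d := by nlinarith
          nlinarith
      have := sq_nonneg ((c : ℝ) * y)
      linarith
    simp [this]
  rw [← integrableOn_iff_integrable_of_support_subset hsupp]
  refine Measure.integrableOn_of_bounded (M := M) (by simp) ?_ ?_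
  · exact ((measurable_cosetTerm hmeas c d r).mul
      (measurable_e_intCast_mul_ofReal m)).aestronglyMeasurable
  · refine Filter.Eventually.of_forall fun x => ?_
    rw [norm_mul, norm_e_intCast_mul_ofReal, mul_one]
    exact hbdd _ _

lemma integral_cosetTerm_mul_e (hy : 0 < y) {c : ℕ} (hc : 1 ≤ c) (d r m : ℤ) :
    ∫ x : ℝ, cosetTerm f y c d r x * e (m * x) =
      y * ∫ x : ℝ, f ((r : ℂ) / c - (1 / ((c : ℂ) ^ 2 * y)) * (1 / (x + Complex.I)))
          (-2 * Complex.arg (x + Complex.I)) * e (m * x * y - m * d / c) := by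
  have hc' : (c : ℂ) ≠ 0 := by exact_mod_cast (by omega : c ≠ 0)
  have hy' : (y : ℂ) ≠ 0 := by exact_mod_cast hy.ne'
  set F : ℝ → ℂ := fun x => cosetTerm f y c d r x * e (m * x) with hF
  have h1 : ∀ x : ℝ, F (x * y - d / c) =
      f ((r : ℂ) / c - (1 / ((c : ℂ) ^ 2 * y)) * (1 / (x + Complex.I)))
          (-2 * Complex.arg (x + Complex.I)) * e (m * x * y - m * d / c) := by
    intro x
    have hw : (c : ℂ) * (((x * y - d / c : ℝ) : ℂ) + y * Complex.I) + d
        = ((c * y : ℝ) : ℂ) * (x + Complex.I) := by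
      push_cast
      field_simp
      ring
    have hcy : (0 : ℝ) < c * y := by
      have : (0 : ℝ) < c := by exact_mod_cast hc
      positivity
    simp only [hF, cosetTerm]
    rw [hw, Complex.arg_real_mul _ hcy]
    congr 2
    · push_cast
      rw [← mul_assoc, one_div_mul_one_div]
      congr 3
      ring
    · push_cast
      ring
  simp_rw [← h1]
  rw [Measure.integral_comp_mul_right (fun x => F (x - d / c)) y,
    integral_sub_right_eq_self F, abs_of_pos (inv_pos.2 hy), Complex.real_smul]
  push_cast
  rw [mul_inv_cancel_left₀ hy']

/-- The `(c, d)` summand of the automorphic lift at `x + iy`, times `e (m x)`. -/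
noncomputable def liftSummand (r : ℕ → ℤ → ℤ) (f : ℂ → ℝ → ℂ) (y : ℝ) (m : ℤ) (c : ℕ) (d : ℤ)
    (x : ℝ) : ℂ :=
  if 1 ≤ c ∧ Int.gcd (c : ℤ) d = 1 then cosetTerm f y c d (r c d) x * e (m * x) else 0

lemma lift_mul_e {a b : ℕ → ℤ → ℤ} (hy : 0 < y)
    (hab : ∀ (c : ℕ) (d : ℤ), 1 ≤ c → Int.gcd (c : ℤ) d = 1 → a c d * d - b c d * (c : ℤ) = 1)
    (m : ℤ) (x : ℝ) :
    lift a b f (x + y * Complex.I) 0 * e (m * x) =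
      f (x + y * Complex.I) 0 * e (m * x) +
        ∑' c : ℕ, ∑' d : ℤ, liftSummand a f y m c d x := by
  rw [lift, add_mul, ← tsum_mul_right]
  congr 1
  refine tsum_congr fun c => ?_
  rw [← tsum_mul_right]
  refine tsum_congr fun d => ?_
  unfold liftSummand
  split_ifs with h
  · rw [apply_moebius_eq_cosetTerm (f := f) hy h.1 (hab c d h.1 h.2)]
  · rw [zero_mul]

lemma liftSummand_eq_zero {B : ℝ} (hB : 1 < B) (hvan : ∀ z θ, z.im < B → f z θ = 0)
    (r : ℕ → ℤ → ℤ) (hy : 0 < y) (m : ℤ) (c : ℕ) (d : ℤ) {x : ℝ}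
    (h : y < (c * x + d) ^ 2 + (c * y) ^ 2) : liftSummand r f y m c d x = 0 := by
  unfold liftSummand
  split_ifs with hc
  · rw [cosetTerm_eq_zero hB hvan hc.1 d _ hy h, zero_mul]
  · rfl

lemma intervalIntegrable_liftSummand {B M : ℝ} (hB : 1 < B)
    (hvan : ∀ z θ, z.im < B → f z θ = 0) (hmeas : Measurable (Function.uncurry f))
    (hbdd : ∀ z θ, ‖f z θ‖ ≤ M) (r : ℕ → ℤ → ℤ) (hy : 0 < y) (m : ℤ) (c : ℕ) (d : ℤ) (s t : ℝ) :
    IntervalIntegrable (liftSummand r f y m c d) volume s t := by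
  by_cases h : 1 ≤ c ∧ Int.gcd (c : ℤ) d = 1
  · have : liftSummand r f y m c d = fun x : ℝ => cosetTerm f y c d (r c d) x * e (m * x) := by
      funext x
      exact if_pos h
    rw [this]
    exact (integrable_cosetTerm_mul_e hB hvan hmeas hbdd hy h.1 d _ m).intervalIntegrable
  · have : liftSummand r f y m c d = fun _ => 0 := by
      funext x
      exact if_neg h
    rw [this]
    exact intervalIntegrable_const

/-- The lift sum is uniformly finite for `0 ≤ x ≤ 1`. -/
lemma exists_liftSummand_eq_zero {B : ℝ} (hB : 1 < B) (hvan : ∀ z θ, z.im < B → f z θ = 0)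
    (hy : 0 < y) : ∃ N D : ℕ, (∀ c : ℕ, N ≤ c → 1 ≤ c ∧ y < (c * y) ^ 2) ∧
      ∀ (r : ℕ → ℤ → ℤ) (m : ℤ) (c : ℕ), c < N → ∀ d : ℤ, d ∉ Finset.Icc (-(D : ℤ)) D →
        ∀ x ∈ Set.Icc (0 : ℝ) 1, liftSummand r f y m c d x = 0 := by
  obtain ⟨N, hN⟩ := exists_nat_gt (1 / y + 1)
  obtain ⟨D, hD⟩ := exists_nat_gt (N + y + 1)
  have hinv : 0 < 1 / y := by positivity
  refine ⟨N, D, fun c hc => ?_, fun r m c hc d hd x hx => ?_⟩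
  · have hc' : (N : ℝ) ≤ c := by exact_mod_cast hc
    have h1 : (1 : ℝ) < c := by linarith
    have h2 : 1 < c * y := by
      rw [← div_lt_iff₀ hy]
      linarith
    refine ⟨by exact_mod_cast h1.le, ?_⟩
    nlinarith
  · apply liftSummand_eq_zero hB hvan r hy
    have hc' : (c : ℝ) ≤ N := by exact_mod_cast hc.le
    have hc0 : (0 : ℝ) ≤ c := by positivity
    have hcx : c * x ≤ c := mul_le_of_le_one_right hc0 hx.2
    have hcx0 : 0 ≤ c * x := mul_nonneg hc0 hx.1
    have h1 : y < (c * x + d) ^ 2 := by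
      rw [Finset.mem_Icc, not_and_or, not_le, not_le] at hd
      rcases hd with hd | hd
      · have hd' : (d : ℝ) < -D := by exact_mod_cast hd
        nlinarith
      · have hd' : (D : ℝ) < d := by exact_mod_cast hd
        nlinarith
    linarith [sq_nonneg ((c : ℝ) * y)]

lemma tsum_int_eq_sum_tsum_residue {u : ℤ → ℂ} (hu : Summable u) (c : ℕ) [NeZero c] :
    ∑' d, u d = ∑ j ∈ Finset.range c, ∑' k : ℤ, u (k * c + (j + 1 : ℕ)) := by
  let σ : Fin c × ℤ ≃ ℤ :=
    ((Equiv.prodComm _ _).trans (Int.divModEquiv c).symm).trans (Equiv.addRight 1)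
  have hσ : ∀ p : Fin c × ℤ, σ p = p.2 * c + ((p.1 : ℕ) + 1 : ℕ) := by
    intro p
    push_cast
    rw [← add_assoc]
    rfl
  rw [← σ.tsum_eq u, Summable.tsum_prod (f := fun p => u (σ p)) (σ.summable_iff.2 hu),
    tsum_fintype, Finset.sum_range]
  simp only [hσ]

lemma modEq_of_mul_modEq_one {c r s d d' : ℤ} (hr : r * d ≡ 1 [ZMOD c])
    (hs : s * d' ≡ 1 [ZMOD c]) (hd : d ≡ d' [ZMOD c]) : r ≡ s [ZMOD c] :=
  calc r = r * 1 := (mul_one r).symm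
    _ ≡ r * (s * d') [ZMOD c] := hs.symm.mul_left r
    _ ≡ r * (s * d) [ZMOD c] := (hd.symm.mul_left s).mul_left r
    _ = r * d * s := by ring
    _ ≡ 1 * s [ZMOD c] := hr.mul_right s
    _ = s := one_mul s

lemma tsum_integral_liftSummand_residue {B M : ℝ} (hB : 1 < B)
    (hvan : ∀ z θ, z.im < B → f z θ = 0) (hmeas : Measurable (Function.uncurry f))
    (hbdd : ∀ z θ, ‖f z θ‖ ≤ M) (hper : ∀ z θ, f (z + 1) θ = f z θ) {r : ℕ → ℤ → ℤ}
    (hr : ∀ (c : ℕ) (d : ℤ), 1 ≤ c → Int.gcd (c : ℤ) d = 1 → r c d * d ≡ 1 [ZMOD c])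
    (hy : 0 < y) (m : ℤ) {c : ℕ} (hc : 1 ≤ c) {d s : ℤ} (hd : Int.gcd (c : ℤ) d = 1)
    (hs : s * d ≡ 1 [ZMOD c]) :
    ∑' k : ℤ, ∫ x in (0 : ℝ)..1, liftSummand r f y m c (k * c + d) x =
      ∫ x : ℝ, cosetTerm f y c d s x * e (m * x) := by
  rw [← (integrable_cosetTerm_mul_e hB hvan hmeas hbdd hy hc d s
    m).hasSum_intervalIntegral_comp_add_int.tsum_eq]
  refine tsum_congr fun k => ?_
  congr 1
  funext x
  have hgcd : Int.gcd (c : ℤ) (k * c + d) = 1 := by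
    rw [add_comm, Int.gcd_add_mul_right_right, hd]
  have hmod : k * c + d ≡ d [ZMOD c] := by
    simp [Int.ModEq]
  rw [liftSummand, if_pos ⟨hc, hgcd⟩, cosetTerm_congr hper hc _
    (modEq_of_mul_modEq_one (hr c _ hc hgcd) hs hmod), cosetTerm_add_mul]
  congr 1
  push_cast
  rw [mul_add, e_add, ← Int.cast_mul, e_intCast, mul_one]

lemma tsum_integral_liftSummand {B M : ℝ} (hB : 1 < B)
    (hvan : ∀ z θ, z.im < B → f z θ = 0) (hmeas : Measurable (Function.uncurry f))
    (hbdd : ∀ z θ, ‖f z θ‖ ≤ M) (hper : ∀ z θ, f (z + 1) θ = f z θ) {r : ℕ → ℤ → ℤ}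
    (hr : ∀ (c : ℕ) (d : ℤ), 1 ≤ c → Int.gcd (c : ℤ) d = 1 → r c d * d ≡ 1 [ZMOD c])
    {s : ℕ → ℕ → ℤ} (hs : ∀ (c d : ℕ), 1 ≤ c → 1 ≤ d → d ≤ c → Nat.gcd d c = 1 →
      s c d * (d : ℤ) ≡ 1 [ZMOD (c : ℤ)])
    (hy : 0 < y) (m : ℤ) (c : ℕ)
    (hsum : Summable fun d : ℤ => ∫ x in (0 : ℝ)..1, liftSummand r f y m c d x) :
    ∑' d : ℤ, ∫ x in (0 : ℝ)..1, liftSummand r f y m c d x =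
      ∑' d : ℕ, if 1 ≤ c ∧ 1 ≤ d ∧ d ≤ c ∧ Nat.gcd d c = 1 then
        ∫ x : ℝ, cosetTerm f y c d (s c d) x * e (m * x) else 0 := by
  rcases Nat.eq_zero_or_pos c with rfl | hc
  · simp [liftSummand]
  have : NeZero c := ⟨hc.ne'⟩
  rw [tsum_int_eq_sum_tsum_residue hsum c, tsum_eq_sum (s := Finset.Ico 1 (c + 1)),
    Finset.sum_Ico_eq_sum_range, Nat.add_sub_cancel]
  · refine Finset.sum_congr rfl fun j hj => ?_
    have hj' : j + 1 ≤ c := Finset.mem_range.1 hj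
    rw [add_comm 1 j]
    split_ifs with h
    · refine tsum_integral_liftSummand_residue hB hvan hmeas hbdd hper hr hy m hc ?_
        (hs c (j + 1) hc h.2.1 h.2.2.1 h.2.2.2)
      rw [Int.gcd_natCast_natCast, Nat.gcd_comm]
      exact h.2.2.2
    · have hz : ∀ k : ℤ, liftSummand r f y m c (k * c + (j + 1 : ℕ)) = fun _ => 0 := by
        intro k
        funext x
        refine if_neg fun h' => h ⟨hc, by omega, hj', ?_⟩
        have h2 := h'.2
        rw [add_comm, Int.gcd_add_mul_right_right, Int.gcd_natCast_natCast, Nat.gcd_comm] at h2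
        exact h2
      simp only [hz, intervalIntegral.integral_zero, tsum_zero]
  · intro d hd
    rw [if_neg]
    rintro ⟨-, h1, h2, -⟩
    exact hd (Finset.mem_Ico.2 ⟨h1, by omega⟩)

end

/-- Double coset expansion (Lemma on the double coset integral). -/
theorem stmt_2 (B : ℝ) (hB : 1 < B) (f : ℂ → ℝ → ℂ)
    (hmeas : Measurable (Function.uncurry f))
    (hbdd : ∃ M : ℝ, ∀ z θ, ‖f z θ‖ ≤ M)
    (hper1 : ∀ z θ, f (z + 1) θ = f z θ)
    (hper2 : ∀ z θ, f z (θ + 2 * Real.pi) = f z θ)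
    (hvan : ∀ z θ, z.im < B → f z θ = 0)
    (a b : ℕ → ℤ → ℤ)
    (hab : ∀ (c : ℕ) (d : ℤ), 1 ≤ c → Int.gcd (c : ℤ) d = 1 →
      a c d * d - b c d * (c : ℤ) = 1)
    (a' : ℕ → ℕ → ℤ)
    (ha' : ∀ (c d : ℕ), 1 ≤ c → 1 ≤ d → d ≤ c → Nat.gcd d c = 1 →
      a' c d * (d : ℤ) ≡ 1 [ZMOD (c : ℤ)])
    (y : ℝ) (hy : 0 < y) (m : ℤ) :
    (∫ x in (0:ℝ)..1, lift a b f ((x : ℂ) + (y : ℂ) * Complex.I) 0 * e ((m : ℂ) * (x : ℂ))) =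
      (∫ x in (0:ℝ)..1, f ((x : ℂ) + (y : ℂ) * Complex.I) 0 * e ((m : ℂ) * (x : ℂ))) +
      (y : ℂ) * ∑' c : ℕ, ∑' d : ℕ,
        (if 1 ≤ c ∧ 1 ≤ d ∧ d ≤ c ∧ Nat.gcd d c = 1 then
          ∫ x : ℝ, f ((a' c d : ℂ) / (c : ℂ) - (1 / ((c : ℂ) ^ 2 * (y : ℂ))) *
              (1 / ((x : ℂ) + Complex.I)))
            (-2 * Complex.arg ((x : ℂ) + Complex.I)) *
            e ((m : ℂ) * (x : ℂ) * (y : ℂ) - (m : ℂ) * (d : ℂ) / (c : ℂ))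
        else 0) := by
  obtain ⟨M, hM⟩ := hbdd
  obtain ⟨N, D, hN, hD⟩ := exists_liftSummand_eq_zero hB hvan hy
  have hr : ∀ (c : ℕ) (d : ℤ), 1 ≤ c → Int.gcd (c : ℤ) d = 1 → a c d * d ≡ 1 [ZMOD c] := by
    intro c d hc hd
    refine (Int.modEq_iff_dvd.2 ⟨-b c d, ?_⟩)
    linear_combination -hab c d hc hd
  have hN0 : ∀ c ∉ Finset.range N, ∀ d x, liftSummand a f y m c d x = 0 := by
    intro c hc d x
    rw [Finset.mem_range, not_lt] at hc
    exact liftSummand_eq_zero hB hvan a hy m c d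
      ((hN c hc).2.trans_le (le_add_of_nonneg_left (sq_nonneg _)))
  have hint0 : ∀ c ∈ Finset.range N, ∀ d ∉ Finset.Icc (-(D : ℤ)) D,
      ∫ x in (0 : ℝ)..1, liftSummand a f y m c d x = 0 := by
    intro c hc d hd
    rw [← intervalIntegral.integral_zero (E := ℂ) (a := (0 : ℝ)) (b := 1) (μ := volume)]
    refine intervalIntegral.integral_congr fun x hx => ?_
    rw [Set.uIcc_of_le zero_le_one] at hx
    exact hD a m c (Finset.mem_range.1 hc) d hd x hx
  have hfinite : ∀ x ∈ Set.uIcc (0 : ℝ) 1,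
      lift a b f (x + y * Complex.I) 0 * e (m * x) =
        f (x + y * Complex.I) 0 * e (m * x) +
          ∑ c ∈ Finset.range N, ∑ d ∈ Finset.Icc (-(D : ℤ)) D, liftSummand a f y m c d x := by
    intro x hx
    rw [Set.uIcc_of_le zero_le_one] at hx
    rw [lift_mul_e hy hab, tsum_eq_sum (s := Finset.range N)]
    · congr 1
      refine Finset.sum_congr rfl fun c hc => ?_
      exact tsum_eq_sum fun d hd => hD a m c (Finset.mem_range.1 hc) d hd x hx
    · intro c hc
      simp [hN0 c hc]
  have hint : ∀ c d, IntervalIntegrable (liftSummand a f y m c d) volume 0 1 := fun c d =>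
    intervalIntegrable_liftSummand hB hvan hmeas hM a hy m c d 0 1
  have hintsum : ∀ c, IntervalIntegrable
      (fun x => ∑ d ∈ Finset.Icc (-(D : ℤ)) D, liftSummand a f y m c d x) volume 0 1 := fun c =>
    intervalIntegrable_fun_sum _ fun d _ => hint c d
  have hf : IntervalIntegrable (fun x : ℝ => f (x + y * Complex.I) 0 * e (m * x)) volume 0 1 := by
    rw [intervalIntegrable_iff]
    refine Measure.integrableOn_of_bounded (M := M) (by simp) ?_ ?_
    · have h : Measurable fun x : ℝ => ((x + y * Complex.I, 0) : ℂ × ℝ) := by fun_prop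
      exact ((hmeas.comp h).mul (measurable_e_intCast_mul_ofReal m)).aestronglyMeasurable
    · refine Filter.Eventually.of_forall fun x => ?_
      rw [norm_mul, norm_e_intCast_mul_ofReal, mul_one]
      exact hM _ _
  rw [intervalIntegral.integral_congr hfinite, intervalIntegral.integral_add hf
    (intervalIntegrable_fun_sum _ fun c _ => hintsum c)]
  congr 1
  rw [intervalIntegral.integral_finsetSum fun c _ => hintsum c,
    ← tsum_mul_left]
  have hterm : ∀ c : ℕ, (y : ℂ) * ∑' d : ℕ,
        (if 1 ≤ c ∧ 1 ≤ d ∧ d ≤ c ∧ Nat.gcd d c = 1 then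
          ∫ x : ℝ, f ((a' c d : ℂ) / (c : ℂ) - (1 / ((c : ℂ) ^ 2 * (y : ℂ))) *
              (1 / ((x : ℂ) + Complex.I)))
            (-2 * Complex.arg ((x : ℂ) + Complex.I)) *
            e ((m : ℂ) * (x : ℂ) * (y : ℂ) - (m : ℂ) * (d : ℂ) / (c : ℂ))
        else 0) = ∑' d : ℕ, if 1 ≤ c ∧ 1 ≤ d ∧ d ≤ c ∧ Nat.gcd d c = 1 then
          ∫ x : ℝ, cosetTerm f y c d (a' c d) x * e (m * x) else 0 := by
    intro c
    rw [← tsum_mul_left]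
    refine tsum_congr fun d => ?_
    split_ifs with h
    · rw [integral_cosetTerm_mul_e hy h.1]
      simp only [Int.cast_natCast]
    · rw [mul_zero]
  simp_rw [hterm]
  have hsum : ∀ c, Summable fun d : ℤ => ∫ x in (0 : ℝ)..1, liftSummand a f y m c d x := by
    intro c
    by_cases hc : c ∈ Finset.range N
    · exact summable_of_ne_finset_zero fun d hd => hint0 c hc d hd
    · simp [hN0 c hc, summable_zero]
  simp_rw [← tsum_integral_liftSummand hB hvan hmeas hM hper1 hr ha' hy m _ (hsum _)]
  rw [tsum_eq_sum (s := Finset.range N) fun c hc => by simp [hN0 c hc]]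
  refine Finset.sum_congr rfl fun c hc => ?_
  rw [intervalIntegral.integral_finsetSum fun d _ => hint c d,
    tsum_eq_sum fun d hd => hint0 c hc d hd]
end

section
/- For every δ > 0 and every ε > 0 there exist T₀ ≥ 2 and r₀ ∈ (0,1) (depending on h, δ, ε) such that for all T ≥ T₀, all y > 0 with T·y ≤ r₀, and all real numbers α < β with β − α ≥ max( T^{−1/6}, (Ty/2)^{1/2} )·(Ty/2)^{−δ}: | (T/(β−α))·∫_α^β Φ_{f_T}(x+iy,0) dx − (3/(2π²))·∫₀^{2π}∫₀¹ h(x,θ) dx dθ | ≤ ε. (Here 2π²/3 is the volume of PSL(2,ℤ)\PSL(2,ℝ) with respect to the measure y⁻² dx dy dθ, and the constant B₁ of the paper is taken to be 2.) -/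
open MeasureTheory

/-- `f_T(z,θ) := 1_{[T,∞)}(Im z) · h(Re z, θ)`. -/
noncomputable def fT (T : ℝ) (h : ℝ → ℝ → ℂ) (z : ℂ) (θ : ℝ) : ℂ :=
  if T ≤ z.im then h z.re θ else 0

open ArithmeticFunction in
lemma sum_moebius_divisors (n : ℕ) :
    ∑ k ∈ n.divisors, (moebius k : ℝ) = if n = 1 then 1 else 0 := by
  have h := congrArg (fun f : ArithmeticFunction ℤ => f n) moebius_mul_coe_zeta
  simp only [coe_mul_zeta_apply, one_apply] at h
  exact_mod_cast h

open ArithmeticFunction in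
lemma coprime_indicator (c : ℕ) (hc : 1 ≤ c) (d : ℤ) :
    (if Int.gcd (c : ℤ) d = 1 then (1 : ℝ) else 0) =
      ∑ k ∈ c.divisors, if (k : ℤ) ∣ d then (moebius k : ℝ) else 0 := by
  rw [← sum_moebius_divisors, ← Finset.sum_filter]
  apply Finset.sum_congr _ fun _ _ => rfl
  ext k
  have h0 : Int.gcd (c : ℤ) d ≠ 0 := by
    intro h
    have := (Int.gcd_eq_zero_iff.mp h).1
    omega
  simp only [Nat.mem_divisors, Finset.mem_filter]
  constructor
  · rintro ⟨h, -⟩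
    have h' : (k : ℤ) ∣ (Int.gcd (c : ℤ) d : ℤ) := by exact_mod_cast h
    exact ⟨⟨by exact_mod_cast h'.trans (Int.gcd_dvd_left ..), by omega⟩,
      h'.trans (Int.gcd_dvd_right ..)⟩
  · rintro ⟨⟨h1, -⟩, h2⟩
    refine ⟨?_, h0⟩
    exact_mod_cast Int.dvd_coe_gcd (by exact_mod_cast h1 : (k : ℤ) ∣ (c : ℤ)) h2

open ArithmeticFunction in
lemma totient_eq_sum_moebius (c : ℕ) (hc : 0 < c) :
    (Nat.totient c : ℝ) = ∑ k ∈ c.divisors, (moebius k : ℝ) * ((c / k : ℕ) : ℝ) := by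
  have h := (sum_eq_iff_sum_mul_moebius_eq (R := ℝ) (f := fun n => (Nat.totient n : ℝ))
    (g := fun n => (n : ℝ))).mp (fun n _ => by exact_mod_cast Nat.sum_totient n) c hc
  rw [← h, Nat.sum_divisorsAntidiagonal (f := fun i j => (moebius i : ℝ) * (j : ℝ))]

lemma card_dvd_Ico (k : ℕ) (hk : 0 < k) (p q : ℝ) (hpq : p ≤ q) :
    |(((Finset.Ico ⌈p⌉ ⌈q⌉).filter (fun d : ℤ => (k : ℤ) ∣ d)).card : ℝ) - (q - p) / k| ≤ 1 := by
  have hk' : (0 : ℤ) < k := by exact_mod_cast hk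
  have hkR : (0 : ℝ) < k := by exact_mod_cast hk
  have h1 : ((Finset.Ico ⌈p⌉ ⌈q⌉).filter (fun d : ℤ => (k : ℤ) ∣ d)).card =
      (Finset.Ico ⌈p / k⌉ ⌈q / k⌉).card := by
    symm
    apply Finset.card_bij (fun m _ => (k : ℤ) * m)
    · intro m hm
      simp only [Finset.mem_Ico, Int.ceil_le, Int.lt_ceil, Finset.mem_filter] at hm ⊢
      rw [div_le_iff₀ hkR, lt_div_iff₀ hkR] at hm
      push_cast
      exact ⟨⟨by linarith, by linarith⟩, dvd_mul_right _ _⟩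
    · intro m _ m' _ h
      exact mul_left_cancel₀ hk'.ne' h
    · intro d hd
      simp only [Finset.mem_Ico, Int.ceil_le, Int.lt_ceil, Finset.mem_filter] at hd
      obtain ⟨⟨h1, h2⟩, m, rfl⟩ := hd
      push_cast at h1 h2
      refine ⟨m, ?_, rfl⟩
      simp only [Finset.mem_Ico, Int.ceil_le, Int.lt_ceil]
      rw [div_le_iff₀ hkR, lt_div_iff₀ hkR]
      exact ⟨by linarith, by linarith⟩
  have hle : ⌈p / k⌉ ≤ ⌈q / k⌉ := Int.ceil_mono (by gcongr)
  have h2 : (((Finset.Ico ⌈p / k⌉ ⌈q / k⌉).card : ℤ) : ℝ) = ⌈q / k⌉ - ⌈p / k⌉ := by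
    rw [Int.card_Ico, Int.toNat_of_nonneg (by omega)]; push_cast; ring
  rw [h1, ← Int.cast_natCast, h2, abs_le, sub_div]
  have a1 := Int.le_ceil (p / (k : ℝ))
  have a2 := Int.ceil_lt_add_one (p / (k : ℝ))
  have a3 := Int.le_ceil (q / (k : ℝ))
  have a4 := Int.ceil_lt_add_one (q / (k : ℝ))
  constructor <;> linarith

open ArithmeticFunction in
lemma card_coprime_Ico (c : ℕ) (hc : 1 ≤ c) (p q : ℝ) (hpq : p ≤ q) :
    |(((Finset.Ico ⌈p⌉ ⌈q⌉).filter (fun d : ℤ => Int.gcd (c : ℤ) d = 1)).card : ℝ) -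
      Nat.totient c * ((q - p) / c)| ≤ c.divisors.card := by
  have hcR : (c : ℝ) ≠ 0 := by positivity
  have h1 : (((Finset.Ico ⌈p⌉ ⌈q⌉).filter (fun d : ℤ => Int.gcd (c : ℤ) d = 1)).card : ℝ) =
      ∑ k ∈ c.divisors, (moebius k : ℝ) *
        (((Finset.Ico ⌈p⌉ ⌈q⌉).filter (fun d : ℤ => (k : ℤ) ∣ d)).card : ℝ) := by
    rw [Finset.card_filter]
    push_cast
    rw [Finset.sum_congr rfl fun d _ => coprime_indicator c hc d, Finset.sum_comm]
    refine Finset.sum_congr rfl fun k _ => ?_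
    rw [Finset.card_filter]
    push_cast
    rw [Finset.mul_sum]
    simp
  rw [h1, totient_eq_sum_moebius c hc, Finset.sum_mul, ← Finset.sum_sub_distrib]
  refine (Finset.abs_sum_le_sum_abs _ _).trans ?_
  rw [Finset.card_eq_sum_ones]
  push_cast
  refine Finset.sum_le_sum fun k hk => ?_
  have hk0 : 0 < k := Nat.pos_of_mem_divisors hk
  have hkR : (k : ℝ) ≠ 0 := by positivity
  rw [Nat.cast_div (Nat.dvd_of_mem_divisors hk) hkR]
  have : (moebius k : ℝ) * ((c : ℝ) / k) * ((q - p) / c) = moebius k * ((q - p) / k) := by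
    field_simp
  rw [this, ← mul_sub, abs_mul]
  have hm : |(moebius k : ℝ)| ≤ 1 := by exact_mod_cast abs_moebius_le_one
  exact mul_le_one₀ hm (abs_nonneg _) (card_dvd_Ico k hk0 p q hpq)

lemma sum_card_divisors_div_le (N : ℕ) :
    ∑ c ∈ Finset.Icc 1 N, (c.divisors.card : ℝ) / c ≤ (∑ c ∈ Finset.Icc 1 N, (1 : ℝ) / c) ^ 2 := by
  have h1 : ∀ c ∈ Finset.Icc 1 N, (c.divisors.card : ℝ) / c =
      ∑ x ∈ c.divisorsAntidiagonal, ((1 : ℝ) / x.1) * (1 / x.2) := by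
    intro c hc
    rw [Nat.sum_divisorsAntidiagonal (f := fun i j : ℕ => ((1 : ℝ) / i) * (1 / j)),
      Finset.card_eq_sum_ones]
    push_cast
    rw [Finset.sum_div]
    refine Finset.sum_congr rfl fun k hk => ?_
    have hk0 : 0 < k := Nat.pos_of_mem_divisors hk
    rw [Nat.cast_div (Nat.dvd_of_mem_divisors hk) (by positivity)]
    have : (0 : ℝ) < c := by
      have := (Finset.mem_Icc.mp hc).1
      exact_mod_cast this
    field_simp
  have hinj : Set.InjOn (fun x : (_ : ℕ) × (ℕ × ℕ) => x.2)
      ((Finset.Icc 1 N).sigma fun c => c.divisorsAntidiagonal : Finset _) := by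
    rintro ⟨c, x⟩ hx ⟨c', x'⟩ hx' h
    simp only [Finset.coe_sigma, Set.mem_sigma_iff, Finset.mem_coe,
      Nat.mem_divisorsAntidiagonal] at hx hx' h
    subst h
    obtain rfl : c = c' := hx.2.1.symm.trans hx'.2.1
    rfl
  rw [Finset.sum_congr rfl h1, Finset.sum_sigma', pow_two, Finset.sum_mul_sum,
    ← Finset.sum_product', ← Finset.sum_image (f := fun x : ℕ × ℕ => (1 : ℝ) / x.1 * (1 / x.2)) hinj]
  refine Finset.sum_le_sum_of_subset_of_nonneg ?_ fun x _ _ => by positivity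
  intro x hx
  simp only [Finset.mem_image, Finset.mem_sigma, Finset.mem_Icc,
    Nat.mem_divisorsAntidiagonal] at hx
  obtain ⟨⟨c, x'⟩, ⟨⟨h1, h2⟩, h3, h4⟩, rfl⟩ := hx
  dsimp only at *
  have p1 : 0 < x'.1 := Nat.pos_of_ne_zero fun h => by simp [h] at h3; omega
  have p2 : 0 < x'.2 := Nat.pos_of_ne_zero fun h => by simp [h] at h3; omega
  simp only [Finset.mem_product, Finset.mem_Icc]
  refine ⟨⟨p1, ?_⟩, p2, ?_⟩
  · nlinarith
  · nlinarith

lemma sum_one_div_le (N : ℕ) : ∑ c ∈ Finset.Icc 1 N, (1 : ℝ) / c ≤ 1 + Real.log N := by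
  have := harmonic_le_one_add_log N
  rw [harmonic_eq_sum_Icc] at this
  push_cast at this
  simpa using this

/-- The summatory function of Euler's totient. -/
noncomputable def totientSum (X : ℝ) : ℝ := ∑ c ∈ Finset.Icc 1 ⌊X⌋₊, (Nat.totient c : ℝ)

lemma totientSum_nonneg (X : ℝ) : 0 ≤ totientSum X := Finset.sum_nonneg fun _ _ => by positivity

lemma totientSum_le (X : ℝ) (hX : 0 ≤ X) : totientSum X ≤ X ^ 2 := by
  have h : ∀ c ∈ Finset.Icc 1 ⌊X⌋₊, (Nat.totient c : ℝ) ≤ X := by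
    intro c hc
    have : ((Nat.totient c : ℕ) : ℝ) ≤ c := by exact_mod_cast Nat.totient_le c
    exact this.trans ((Nat.le_floor_iff hX).mp (Finset.mem_Icc.mp hc).2)
  refine (Finset.sum_le_card_nsmul _ _ _ h).trans ?_
  simp only [Nat.card_Icc, add_tsub_cancel_right, nsmul_eq_mul, pow_two]
  gcongr
  exact Nat.floor_le hX

lemma totientSum_eq (N : ℕ) (X : ℝ) (hN : ⌊X⌋₊ = N) :
    totientSum X = ∑' k : ℕ, (ArithmeticFunction.moebius k : ℝ) *
      (((N / k : ℕ) : ℝ) * ((N / k : ℕ) + 1) / 2) := by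
  have hs : ∀ M : ℕ, ∑ j ∈ Finset.Icc 1 M, (j : ℝ) = (M : ℝ) * (M + 1) / 2 := by
    intro M
    induction M with
    | zero => simp
    | succ n ih => rw [Finset.sum_Icc_succ_top (by omega), ih]; push_cast; ring
  rw [tsum_eq_sum (s := Finset.Icc 1 N)]
  · simp_rw [← hs, Finset.mul_sum]
    rw [totientSum, hN, Finset.sum_congr rfl fun c hc => totient_eq_sum_moebius c
      (Finset.mem_Icc.mp hc).1]
    rw [Finset.sum_congr rfl fun c _ => (Nat.sum_divisorsAntidiagonal
      (f := fun i j : ℕ => (ArithmeticFunction.moebius i : ℝ) * (j : ℝ)) (n := c)).symm]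
    rw [Finset.sum_sigma', Finset.sum_sigma']
    refine Finset.sum_bij' (fun x _ => ⟨x.2.1, x.2.2⟩) (fun x _ => ⟨x.1 * x.2, (x.1, x.2)⟩)
      ?_ ?_ ?_ ?_ ?_
    · rintro ⟨c, x⟩ hx
      simp only [Finset.mem_sigma, Finset.mem_Icc, Nat.mem_divisorsAntidiagonal] at hx ⊢
      obtain ⟨⟨h1, h2⟩, h3, h4⟩ := hx
      have p1 : 0 < x.1 := Nat.pos_of_ne_zero fun h => by simp [h] at h3; omega
      have p2 : 0 < x.2 := Nat.pos_of_ne_zero fun h => by simp [h] at h3; omega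
      refine ⟨⟨p1, by nlinarith⟩, p2, ?_⟩
      rw [Nat.le_div_iff_mul_le p1]
      nlinarith
    · rintro ⟨k, j⟩ hx
      simp only [Finset.mem_sigma, Finset.mem_Icc, Nat.mem_divisorsAntidiagonal] at hx ⊢
      obtain ⟨⟨h1, h2⟩, h3, h4⟩ := hx
      rw [Nat.le_div_iff_mul_le h1] at h4
      have : 0 < k * j := Nat.mul_pos h1 h3
      exact ⟨⟨this, by nlinarith⟩, trivial, this.ne'⟩
    · rintro ⟨c, x⟩ hx
      simp only [Finset.mem_sigma, Finset.mem_Icc, Nat.mem_divisorsAntidiagonal] at hx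
      obtain ⟨-, rfl, -⟩ := hx
      rfl
    · rintro ⟨k, j⟩ hx
      rfl
    · rintro ⟨c, x⟩ hx
      rfl
  · intro k hk
    rcases Nat.eq_zero_or_pos k with rfl | h
    · simp
    · rw [Nat.div_eq_of_lt (by simp at hk; omega)]
      simp

open ArithmeticFunction in
lemma tsum_moebius_div_sq : ∑' k : ℕ, (moebius k : ℝ) * (1 / (2 * (k : ℝ) ^ 2)) = 3 / Real.pi ^ 2 := by
  have h1 := LSeries_zeta_mul_Lseries_moebius (s := 2) (by norm_num)
  rw [LSeries_zeta_eq_riemannZeta (by norm_num), riemannZeta_two] at h1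
  have h2 : LSeries (fun n => ((moebius n : ℤ) : ℂ)) 2 =
      ((2 * ∑' k : ℕ, (moebius k : ℝ) * (1 / (2 * (k : ℝ) ^ 2)) : ℝ) : ℂ) := by
    rw [LSeries, ← tsum_mul_left, Complex.ofReal_tsum]
    refine tsum_congr fun k => ?_
    rcases eq_or_ne k 0 with rfl | hk
    · simp
    · rw [LSeries.term_of_ne_zero hk]
      push_cast
      have : (k : ℂ) ≠ 0 := by exact_mod_cast hk
      rw [Complex.cpow_ofNat]
      field_simp
  rw [h2] at h1
  have h3 : Real.pi ^ 2 / 6 * (2 * ∑' k : ℕ, (moebius k : ℝ) * (1 / (2 * (k : ℝ) ^ 2))) = 1 := by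
    exact_mod_cast h1
  have := Real.pi_pos
  field_simp at h3 ⊢
  linarith

open Filter Topology in
lemma tendsto_totientSum_div :
    Tendsto (fun X : ℝ => totientSum X / X ^ 2) atTop (𝓝 (3 / Real.pi ^ 2)) := by
  rw [← tsum_moebius_div_sq]
  have key : Tendsto (fun X : ℝ => ∑' k : ℕ, (ArithmeticFunction.moebius k : ℝ) *
      (((⌊X⌋₊ / k : ℕ) : ℝ) * ((⌊X⌋₊ / k : ℕ) + 1) / 2) / X ^ 2) atTop
      (𝓝 (∑' k : ℕ, (ArithmeticFunction.moebius k : ℝ) * (1 / (2 * (k : ℝ) ^ 2)))) := by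
    refine tendsto_tsum_of_dominated_convergence (bound := fun k : ℕ => 1 / (k : ℝ) ^ 2)
      (Real.summable_one_div_nat_pow.mpr one_lt_two) ?_ ?_
    · intro k
      rcases Nat.eq_zero_or_pos k with rfl | hk
      · simp
      have hkR : (0 : ℝ) < k := by exact_mod_cast hk
      have h1 : Tendsto (fun X : ℝ => ((⌊X⌋₊ / k : ℕ) : ℝ) / X) atTop (𝓝 (1 / k)) := by
        have := (tendsto_nat_floor_mul_div_atTop (R := ℝ) (a := 1 / k) (by positivity))
        refine this.congr fun X => ?_
        rw [← Nat.floor_div_natCast]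
        rw [show 1 / (k : ℝ) * X = X / k by ring]
      have h0 : Tendsto (fun X : ℝ => 1 / X) atTop (𝓝 0) := by
        simpa only [one_div] using (tendsto_inv_atTop_zero : Tendsto (fun r : ℝ => r⁻¹) atTop (𝓝 0))
      have h2 : Tendsto (fun X : ℝ => ((⌊X⌋₊ / k : ℕ) : ℝ) / X + 1 / X) atTop (𝓝 (1 / k + 0)) :=
        h1.add h0
      have h3 := ((h1.mul h2).const_mul ((ArithmeticFunction.moebius k : ℝ) / 2))
      refine (h3.congr' ?_).trans_eq ?_
      · filter_upwards [eventually_gt_atTop 0] with X hX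
        field_simp
      · congr 1
        field_simp
        ring
    · filter_upwards [eventually_ge_atTop 1] with X hX k
      rcases Nat.eq_zero_or_pos k with rfl | hk
      · simp
      have hkR : (0 : ℝ) < k := by exact_mod_cast hk
      have hm : |(ArithmeticFunction.moebius k : ℝ)| ≤ 1 := by
        exact_mod_cast ArithmeticFunction.abs_moebius_le_one
      have hX0 : 0 < X := by linarith
      have hq : ((⌊X⌋₊ / k : ℕ) : ℝ) ≤ X / k := by
        refine Nat.cast_div_le.trans ?_
        gcongr
        exact Nat.floor_le hX0.le
      have hq2 : ((⌊X⌋₊ / k : ℕ) : ℝ) * (((⌊X⌋₊ / k : ℕ) : ℝ) + 1) / 2 ≤ (X / k) ^ 2 := by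
        have h5 : ((⌊X⌋₊ / k : ℕ) : ℝ) * (((⌊X⌋₊ / k : ℕ) : ℝ) + 1) / 2 ≤
            ((⌊X⌋₊ / k : ℕ) : ℝ) ^ 2 := by
          have : (⌊X⌋₊ / k) * ((⌊X⌋₊ / k) + 1) ≤ 2 * (⌊X⌋₊ / k) ^ 2 := by nlinarith [Nat.le_self_pow (two_ne_zero) (⌊X⌋₊ / k)]
          have : ((⌊X⌋₊ / k : ℕ) : ℝ) * (((⌊X⌋₊ / k : ℕ) : ℝ) + 1) ≤
            2 * ((⌊X⌋₊ / k : ℕ) : ℝ) ^ 2 := by exact_mod_cast this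
          linarith
        refine h5.trans ?_
        gcongr
      rw [norm_div, norm_mul, Real.norm_eq_abs, Real.norm_of_nonneg (by positivity),
        Real.norm_of_nonneg (by positivity), div_le_iff₀ (by positivity)]
      calc _ ≤ 1 * (X / k) ^ 2 := by gcongr
        _ = _ := by ring
  refine key.congr fun X => ?_
  rw [totientSum_eq _ X rfl, tsum_div_const]

/-- The character `(x, θ) ↦ e(m x) exp(i n θ)`. -/
noncomputable def torusChar (m n : ℤ) (x θ : ℝ) : ℂ :=
  Complex.exp (((2 * Real.pi * m * x + n * θ : ℝ) : ℂ) * Complex.I)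

lemma norm_torusChar (m n : ℤ) (x θ : ℝ) : ‖torusChar m n x θ‖ = 1 :=
  Complex.norm_exp_ofReal_mul_I _

lemma continuous_torusChar (m n : ℤ) : Continuous (Function.uncurry (torusChar m n)) := by
  unfold torusChar Function.uncurry
  fun_prop

lemma one_add_sq_sq_le (η t : ℝ) (hη : 0 < η) :
    η / (η + 4) * (1 + t ^ 2) ^ 2 ≤ (1 - t ^ 2) ^ 2 + η := by
  rw [div_mul_eq_mul_div, div_le_iff₀ (by positivity)]
  nlinarith [sq_nonneg (2 * (1 - t ^ 2) + η)]

open Filter Topology in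
lemma exists_integral_le (ε : ℝ) (hε : 0 < ε) :
    ∃ η : ℝ, 0 < η ∧ Integrable (fun t : ℝ => η / ((1 - t ^ 2) ^ 2 + η)) ∧
      ∫ t : ℝ, η / ((1 - t ^ 2) ^ 2 + η) ≤ ε := by
  have hb : ∀ η : ℝ, 0 < η → η ≤ 1 → ∀ t : ℝ,
      ‖η / ((1 - t ^ 2) ^ 2 + η)‖ ≤ 5 * (1 + t ^ 2)⁻¹ := by
    intro η h0 h1 t
    have h2 := one_add_sq_sq_le η t h0
    rw [Real.norm_of_nonneg (by positivity), ← div_eq_mul_inv,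
      div_le_div_iff₀ (by positivity) (by positivity)]
    rw [div_mul_eq_mul_div, div_le_iff₀ (by positivity)] at h2
    have h3 : 1 + t ^ 2 ≤ (1 + t ^ 2) ^ 2 := by nlinarith [sq_nonneg t]
    have h4 : η * (1 + t ^ 2) ≤ η * (1 + t ^ 2) ^ 2 := by gcongr
    nlinarith [sq_nonneg (1 - t ^ 2)]
  have hm : ∀ η : ℝ, Measurable (fun t : ℝ => η / ((1 - t ^ 2) ^ 2 + η)) := fun η => by fun_prop
  have hi : Integrable (fun t : ℝ => 5 * (1 + t ^ 2)⁻¹) := integrable_inv_one_add_sq.const_mul 5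
  have hlim : Tendsto (fun η : ℝ => ∫ t : ℝ, η / ((1 - t ^ 2) ^ 2 + η)) (𝓝[>] 0)
      (𝓝 (∫ _ : ℝ, (0 : ℝ))) := by
    refine tendsto_integral_filter_of_dominated_convergence (fun t : ℝ => 5 * (1 + t ^ 2)⁻¹)
      (Eventually.of_forall fun η => (hm η).aestronglyMeasurable) ?_ hi ?_
    · filter_upwards [Ioc_mem_nhdsGT (zero_lt_one' ℝ)] with η hη
      exact Eventually.of_forall (hb η hη.1 hη.2)
    · have hfin : ∀ᵐ t : ℝ, t ∉ ({1, -1} : Set ℝ) :=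
        (Set.Finite.measure_zero (by simp) volume : volume ({1, -1} : Set ℝ) = 0) |>
          measure_eq_zero_iff_ae_notMem.mp
      filter_upwards [hfin] with t ht
      have ht2 : (1 - t ^ 2) ^ 2 ≠ 0 := by
        simp only [Set.mem_insert_iff, Set.mem_singleton_iff, not_or] at ht
        have : 1 - t ^ 2 = (1 - t) * (1 + t) := by ring
        rw [this]
        refine pow_ne_zero _ (mul_ne_zero (sub_ne_zero.mpr (Ne.symm ht.1)) fun h => ht.2 ?_)
        linarith
      have : Tendsto (fun η : ℝ => η / ((1 - t ^ 2) ^ 2 + η)) (𝓝 0)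
          (𝓝 (0 / ((1 - t ^ 2) ^ 2 + 0))) := by
        refine ContinuousAt.tendsto (f := fun η : ℝ => η / ((1 - t ^ 2) ^ 2 + η)) ?_
        exact ContinuousAt.div (by fun_prop) (by fun_prop) (by simpa using ht2)
      rw [zero_div] at this
      exact this.mono_left nhdsWithin_le_nhds
  rw [integral_zero] at hlim
  have h1 := hlim.eventually (eventually_le_nhds hε)
  obtain ⟨η, h2, h3⟩ := (h1.and (Ioc_mem_nhdsGT (zero_lt_one' ℝ))).exists
  exact ⟨η, h3.1, hi.mono' (hm η).aestronglyMeasurable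
    (Eventually.of_forall (hb η h3.1 h3.2)), h2⟩

lemma oscillatory_bound (m n : ℤ) (hm : m ≠ 0) (ε : ℝ) (hε : 0 < ε) :
    ∃ K : ℝ, 0 ≤ K ∧ ∀ R : ℝ, 0 < R → ∀ r L p q : ℝ, -L ≤ p → p ≤ q → q ≤ L →
      ‖∫ t in p..q, torusChar m n (r - R * (t / (t ^ 2 + 1))) (2 * Real.arctan t - Real.pi)‖ ≤
        ε + K * (1 + L) * (1 + L ^ 2) / R := by
  obtain ⟨η, hη, hηi, hηε⟩ := exists_integral_le ε hε
  obtain ⟨k, hk⟩ : ∃ k, k = η / (η + 4) := ⟨_, rfl⟩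
  have hk0 : 0 < k := by rw [hk]; positivity
  obtain ⟨B, hB⟩ : ∃ B, B = 6 / k + 4 / k ^ 2 + 2 * |(n : ℝ)| / k := ⟨_, rfl⟩
  have hB0 : 0 ≤ B := by rw [hB]; positivity
  refine ⟨2 / k + 2 * B, by positivity, fun R hR r L p q hp hpq hq => ?_⟩
  have hL : 0 ≤ L := by linarith
  set E : ℝ → ℂ := fun t =>
    torusChar m n (r - R * (t / (t ^ 2 + 1))) (2 * Real.arctan t - Real.pi) with hE
  set D : ℝ → ℝ := fun t => (1 - t ^ 2) ^ 2 + η with hD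
  have hDpos : ∀ t, 0 < D t := fun t => by simp only [hD]; positivity
  have hDk : ∀ t, k * (1 + t ^ 2) ^ 2 ≤ D t := fun t => hk ▸ one_add_sq_sq_le η t hη
  set w : ℝ → ℝ := fun t => (1 - t ^ 2) * (1 + t ^ 2) ^ 2 / D t with hw
  set w' : ℝ → ℝ := fun t => ((-(2 * t) * (1 + t ^ 2) ^ 2 + (1 - t ^ 2) * (2 * (1 + t ^ 2) * (2 * t)))
    * D t - (1 - t ^ 2) * (1 + t ^ 2) ^ 2 * (2 * (1 - t ^ 2) * -(2 * t))) / D t ^ 2 with hw'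
  have hwd : ∀ t, HasDerivAt w (w' t) t := by
    intro t
    have h0 : HasDerivAt (fun t : ℝ => t ^ 2) (2 * t) t := by simpa using hasDerivAt_pow 2 t
    have h1 : HasDerivAt (fun t : ℝ => 1 - t ^ 2) (-(2 * t)) t := by simpa using h0.const_sub 1
    have h2 : HasDerivAt (fun t : ℝ => 1 + t ^ 2) (2 * t) t := by simpa using h0.const_add 1
    have h3 := h2.pow 2
    have h4 := h1.pow 2
    have h5 := (h1.mul h3).div (h4.add_const η) (hDpos t).ne'
    refine h5.congr_deriv ?_
    simp [hw', hD]
  have hwb : ∀ t, |w t| ≤ (1 + t ^ 2) / k := by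
    intro t
    simp only [hw]
    rw [abs_div, abs_of_pos (hDpos t), abs_mul, abs_of_nonneg (by positivity : 0 ≤ (1 + t ^ 2) ^ 2),
      div_le_div_iff₀ (hDpos t) hk0]
    have h1 : |1 - t ^ 2| ≤ 1 + t ^ 2 := by rw [abs_le]; constructor <;> nlinarith [sq_nonneg t]
    calc |1 - t ^ 2| * (1 + t ^ 2) ^ 2 * k = |1 - t ^ 2| * (k * (1 + t ^ 2) ^ 2) := by ring
      _ ≤ (1 + t ^ 2) * D t := by gcongr; exact hDk t
  have hw'b : ∀ t, |w' t| ≤ (6 / k + 4 / k ^ 2) * (1 + t ^ 2) := by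
    intro t
    have h1 : |1 - t ^ 2| ≤ 1 + t ^ 2 := by rw [abs_le]; constructor <;> nlinarith [sq_nonneg t]
    have ht : |t| ≤ 1 + t ^ 2 := by
      rw [abs_le]; constructor <;> nlinarith [sq_nonneg (t - 1), sq_nonneg (t + 1)]
    have hsplit : w' t = (-(2 * t) * (1 + t ^ 2) ^ 2 + 4 * (1 - t ^ 2) * (1 + t ^ 2) * t) / D t +
        4 * (1 - t ^ 2) ^ 2 * (1 + t ^ 2) ^ 2 * t / D t ^ 2 := by
      have := (hDpos t).ne'
      simp only [hw']
      field_simp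
      ring
    rw [hsplit]
    have e1 : |(-(2 * t) * (1 + t ^ 2) ^ 2 + 4 * (1 - t ^ 2) * (1 + t ^ 2) * t) / D t| ≤
        6 / k * (1 + t ^ 2) := by
      rw [abs_div, abs_of_pos (hDpos t), div_le_iff₀ (hDpos t)]
      calc _ ≤ |-(2 * t) * (1 + t ^ 2) ^ 2| + |4 * (1 - t ^ 2) * (1 + t ^ 2) * t| := abs_add_le _ _
        _ = 2 * |t| * (1 + t ^ 2) ^ 2 + 4 * |1 - t ^ 2| * (1 + t ^ 2) * |t| := by
          simp only [abs_mul, abs_neg, abs_of_nonneg (by positivity : (0 : ℝ) ≤ (1 + t ^ 2) ^ 2),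
            abs_of_nonneg (by positivity : (0 : ℝ) ≤ (1 + t ^ 2))]
          norm_num
        _ ≤ 2 * |t| * (1 + t ^ 2) ^ 2 + 4 * (1 + t ^ 2) * (1 + t ^ 2) * |t| := by gcongr
        _ = 6 / k * |t| * (k * (1 + t ^ 2) ^ 2) := by field_simp; ring
        _ ≤ 6 / k * (1 + t ^ 2) * D t := by gcongr; exact hDk t
    have e2 : |4 * (1 - t ^ 2) ^ 2 * (1 + t ^ 2) ^ 2 * t / D t ^ 2| ≤ 4 / k ^ 2 * (1 + t ^ 2) := by
      rw [abs_div, abs_of_pos (pow_pos (hDpos t) 2), div_le_iff₀ (pow_pos (hDpos t) 2)]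
      have h2 : (1 - t ^ 2) ^ 2 ≤ (1 + t ^ 2) ^ 2 := by nlinarith [sq_nonneg t]
      calc _ = 4 * (1 - t ^ 2) ^ 2 * (1 + t ^ 2) ^ 2 * |t| := by
            rw [abs_mul, abs_of_nonneg (by positivity : 0 ≤ 4 * (1 - t ^ 2) ^ 2 * (1 + t ^ 2) ^ 2)]
        _ ≤ 4 * (1 + t ^ 2) ^ 2 * (1 + t ^ 2) ^ 2 * |t| := by gcongr
        _ = 4 / k ^ 2 * |t| * (k * (1 + t ^ 2) ^ 2) ^ 2 := by field_simp
        _ ≤ 4 / k ^ 2 * (1 + t ^ 2) * D t ^ 2 := by gcongr; exact hDk t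
    calc _ ≤ _ := abs_add_le _ _
      _ ≤ _ := add_le_add e1 e2
      _ = _ := by ring
  have hEc : Continuous E := by
    have : Continuous fun t : ℝ => t / (t ^ 2 + 1) :=
      Continuous.div (by fun_prop) (by fun_prop) fun t => by positivity
    have h2 : Continuous fun t : ℝ => (r - R * (t / (t ^ 2 + 1)), 2 * Real.arctan t - Real.pi) := by
      fun_prop
    exact (continuous_torusChar m n).comp h2
  have hEn : ∀ t, ‖E t‖ = 1 := fun t => norm_torusChar ..
  obtain ⟨M, hM⟩ : ∃ M : ℝ, M = 2 * Real.pi * m * R := ⟨_, rfl⟩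
  have hMR : R ≤ |M| := by
    have h1 : (1 : ℝ) ≤ |(m : ℝ)| := by exact_mod_cast Int.one_le_abs hm
    rw [hM, abs_mul, abs_mul, abs_of_pos hR, abs_of_pos (by positivity : 0 < 2 * Real.pi)]
    have := Real.two_le_pi
    nlinarith [mul_pos hR hR, mul_le_mul h1 (by linarith : (1 : ℝ) ≤ 2 * Real.pi) zero_le_one (abs_nonneg _)]
  have hM0 : 0 < |M| := by linarith
  set g : ℝ → ℂ := fun t => E t * ((w' t + 2 * n * w t / (1 + t ^ 2) * Complex.I : ℂ)) with hg
  have hfd : ∀ t, HasDerivAt (fun t => E t * (w t : ℂ))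
      (g t - Complex.I * M * E t + Complex.I * M * ((η / D t : ℝ) * E t)) t := by
    intro t
    have hp1 : HasDerivAt (fun t : ℝ => t / (t ^ 2 + 1)) ((1 - t ^ 2) / (t ^ 2 + 1) ^ 2) t := by
      have h0 : HasDerivAt (fun t : ℝ => t ^ 2 + 1) (2 * t) t := by
        simpa using (hasDerivAt_pow 2 t).add_const 1
      refine ((hasDerivAt_id t).div h0 (by positivity)).congr_deriv ?_
      simp
      ring
    have hp2 : HasDerivAt (fun t : ℝ => 2 * Real.pi * m * (r - R * (t / (t ^ 2 + 1))) +
        n * (2 * Real.arctan t - Real.pi))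
        (2 * Real.pi * m * (-(R * ((1 - t ^ 2) / (t ^ 2 + 1) ^ 2))) +
          n * (2 * (1 / (1 + t ^ 2)))) t :=
      (((hp1.const_mul R).const_sub r).const_mul _).add
        ((((Real.hasDerivAt_arctan t).const_mul 2).sub_const _).const_mul _)
    have hEd := ((hp2.ofReal_comp.mul_const Complex.I).cexp).mul ((hwd t).ofReal_comp)
    refine hEd.congr_deriv ?_
    have e1 : Complex.exp (((2 * Real.pi * m * (r - R * (t / (t ^ 2 + 1))) +
        n * (2 * Real.arctan t - Real.pi) : ℝ) : ℂ) * Complex.I) = E t := rfl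
    rw [e1]
    have e2 : (1 - t ^ 2) / (t ^ 2 + 1) ^ 2 * w t = 1 - η / D t := by
      have := (hDpos t).ne'
      simp only [hw]
      field_simp
      simp only [hD]
      ring
    have e3 : (2 * Real.pi * m * (-(R * ((1 - t ^ 2) / (t ^ 2 + 1) ^ 2))) +
          n * (2 * (1 / (1 + t ^ 2)))) * w t = -M * (1 - η / D t) + 2 * n * w t / (1 + t ^ 2) := by
      rw [← e2, hM]; ring
    have e4 := congrArg (fun x : ℝ => (x : ℂ)) e3
    simp only [Complex.ofReal_mul _ (w t)] at e4
    simp only [hg]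
    calc _ = E t * w' t + E t * Complex.I * (((2 * Real.pi * m * (-(R * ((1 - t ^ 2) /
          (t ^ 2 + 1) ^ 2))) + n * (2 * (1 / (1 + t ^ 2))) : ℝ) : ℂ) * (w t : ℂ)) := by ring
      _ = _ := by rw [e4]; push_cast; ring
  have hDc : Continuous D := by simp only [hD]; fun_prop
  have hwc : Continuous w := continuous_iff_continuousAt.mpr fun t => (hwd t).continuousAt
  have hw'c : Continuous w' := by
    simp only [hw']
    exact Continuous.div (by fun_prop) (by fun_prop) fun t => (pow_pos (hDpos t) 2).ne'
  have hgc : Continuous g := by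
    have : Continuous fun t : ℝ => 2 * n * (w t : ℂ) / (1 + (t : ℂ) ^ 2) := by
      refine Continuous.div (by fun_prop) (by fun_prop) fun t => ?_
      have : (1 + t ^ 2 : ℝ) ≠ 0 := by positivity
      exact_mod_cast this
    simp only [hg]
    fun_prop
  have hηc : Continuous fun t => ((η / D t : ℝ) : ℂ) * E t := by
    have : Continuous fun t => η / D t := Continuous.div (by fun_prop) hDc fun t => (hDpos t).ne'
    fun_prop
  have hftc := intervalIntegral.integral_eq_sub_of_hasDerivAt (a := p) (b := q) (fun t _ => hfd t)
    (((hgc.sub (continuous_const.mul hEc)).add (continuous_const.mul hηc)).intervalIntegrable _ _)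
  have hc1 : Continuous fun t => Complex.I * M * E t := by fun_prop
  have hc2 : Continuous fun t => Complex.I * M * (((η / D t : ℝ) : ℂ) * E t) :=
    continuous_const.mul hηc
  have hc3 : Continuous fun t => g t - Complex.I * M * E t := hgc.sub hc1
  rw [intervalIntegral.integral_add (hc3.intervalIntegrable _ _) (hc2.intervalIntegrable _ _),
    intervalIntegral.integral_sub (hgc.intervalIntegrable _ _) (hc1.intervalIntegrable _ _),
    intervalIntegral.integral_const_mul,
    intervalIntegral.integral_const_mul] at hftc
  have hkey : Complex.I * M * (∫ t in p..q, E t) = (∫ t in p..q, g t) +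
      Complex.I * M * (∫ t in p..q, ((η / D t : ℝ) : ℂ) * E t) - E q * w q + E p * w p := by
    linear_combination -hftc
  have bsq : ∀ t, -L ≤ t → t ≤ L → 1 + t ^ 2 ≤ 1 + L ^ 2 := by
    intro t h1 h2; nlinarith
  have bend : ∀ t, -L ≤ t → t ≤ L → ‖E t * (w t : ℂ)‖ ≤ (1 + L ^ 2) / k := by
    intro t h1 h2
    rw [norm_mul, hEn, one_mul, Complex.norm_real, Real.norm_eq_abs]
    refine (hwb t).trans ?_
    gcongr ?_ / k
    exact bsq t h1 h2
  have bg : ‖∫ t in p..q, g t‖ ≤ B * (1 + L ^ 2) * (2 * L) := by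
    have : ‖∫ t in p..q, g t‖ ≤ B * (1 + L ^ 2) * |q - p| := by
      refine intervalIntegral.norm_integral_le_of_norm_le_const fun t ht => ?_
      rw [Set.uIoc_of_le hpq] at ht
      have h1 : -L ≤ t := by linarith [ht.1]
      have h2 : t ≤ L := by linarith [ht.2]
      simp only [hg]
      rw [norm_mul, hEn, one_mul]
      have e5 : ‖(2 * n * w t / (1 + t ^ 2) * Complex.I : ℂ)‖ ≤ 2 * |(n : ℝ)| / k * (1 + t ^ 2) := by
        have : (2 * n * w t / (1 + t ^ 2) * Complex.I : ℂ) =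
          ((2 * n * w t / (1 + t ^ 2) : ℝ) : ℂ) * Complex.I := by push_cast; rfl
        rw [this, norm_mul, Complex.norm_I, mul_one, Complex.norm_real, Real.norm_eq_abs, abs_div,
          abs_mul, abs_mul, abs_of_pos (by positivity : (0 : ℝ) < 1 + t ^ 2), abs_two]
        calc _ ≤ 2 * |(n : ℝ)| * |w t| / 1 := by
              gcongr
              nlinarith [sq_nonneg t]
          _ ≤ 2 * |(n : ℝ)| * ((1 + t ^ 2) / k) / 1 := by gcongr; exact hwb t
          _ = _ := by ring
      calc _ ≤ ‖((w' t : ℝ) : ℂ)‖ + _ := norm_add_le _ _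
        _ ≤ (6 / k + 4 / k ^ 2) * (1 + t ^ 2) + 2 * |(n : ℝ)| / k * (1 + t ^ 2) := by
          refine add_le_add ?_ e5
          rw [Complex.norm_real]
          exact hw'b t
        _ = B * (1 + t ^ 2) := by rw [hB]; ring
        _ ≤ _ := by gcongr ?_ * ?_; exact bsq t h1 h2
    refine this.trans ?_
    gcongr
    rw [abs_of_nonneg (by linarith)]
    linarith
  have bη : ‖∫ t in p..q, ((η / D t : ℝ) : ℂ) * E t‖ ≤ ε := by
    calc _ ≤ ∫ t in p..q, ‖((η / D t : ℝ) : ℂ) * E t‖ :=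
          intervalIntegral.norm_integral_le_integral_norm hpq
      _ = ∫ t in p..q, η / D t := by
          congr 1; ext t
          rw [norm_mul, hEn, mul_one, Complex.norm_real, Real.norm_of_nonneg]
          exact div_nonneg hη.le (hDpos t).le
      _ = ∫ t in Set.Ioc p q, η / D t := intervalIntegral.integral_of_le hpq
      _ ≤ ∫ t, η / D t := setIntegral_le_integral hηi
          (Filter.Eventually.of_forall fun t => div_nonneg hη.le (hDpos t).le)
      _ ≤ ε := hηε
  have hnorm : |M| * ‖∫ t in p..q, E t‖ ≤
      B * (1 + L ^ 2) * (2 * L) + |M| * ε + (1 + L ^ 2) / k + (1 + L ^ 2) / k := by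
    have hIM : ‖Complex.I * (M : ℂ)‖ = |M| := by
      rw [norm_mul, Complex.norm_I, one_mul, Complex.norm_real, Real.norm_eq_abs]
    rw [← hIM, ← norm_mul, hkey]
    refine (norm_add_le _ _).trans (add_le_add ((norm_sub_le _ _).trans (add_le_add
      ((norm_add_le _ _).trans (add_le_add bg ?_)) (bend q (by linarith) hq)))
      (bend p hp (by linarith)))
    rw [norm_mul]
    gcongr
  have hfin : ‖∫ t in p..q, E t‖ ≤ ε + (B * (1 + L ^ 2) * (2 * L) + (1 + L ^ 2) / k +
      (1 + L ^ 2) / k) / |M| := by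
    rw [← sub_le_iff_le_add', le_div_iff₀ hM0]
    linarith
  refine hfin.trans ?_
  have : (B * (1 + L ^ 2) * (2 * L) + (1 + L ^ 2) / k + (1 + L ^ 2) / k) / |M| ≤
      (B * (1 + L ^ 2) * (2 * L) + (1 + L ^ 2) / k + (1 + L ^ 2) / k) / R := by
    gcongr
  have h2 : B * (1 + L ^ 2) * (2 * L) + (1 + L ^ 2) / k + (1 + L ^ 2) / k ≤
      (2 / k + 2 * B) * (1 + L) * (1 + L ^ 2) := by
    have : (2 / k + 2 * B) * (1 + L) * (1 + L ^ 2) - (B * (1 + L ^ 2) * (2 * L) + (1 + L ^ 2) / k +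
      (1 + L ^ 2) / k) = 2 / k * L * (1 + L ^ 2) + 2 * B * (1 + L ^ 2) := by ring
    have : 0 ≤ 2 / k * L * (1 + L ^ 2) + 2 * B * (1 + L ^ 2) := by positivity
    linarith
  have h3 : (B * (1 + L ^ 2) * (2 * L) + (1 + L ^ 2) / k + (1 + L ^ 2) / k) / R ≤
      (2 / k + 2 * B) * (1 + L) * (1 + L ^ 2) / R := by gcongr
  linarith

/-- Data of a horocycle segment: a choice of coset representatives, the cusp height `T`, the
height `y` of the horocycle, and the end points of the segment. -/
structure HoroParam where
  a : ℕ → ℤ → ℤ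
  b : ℕ → ℤ → ℤ
  T : ℝ
  y : ℝ
  α : ℝ
  β : ℝ

/-- Admissible horocycle data in the shrinking target problem. -/
structure HoroParam.Valid (δ : ℝ) (p : HoroParam) : Prop where
  det : ∀ (c : ℕ) (d : ℤ), 1 ≤ c → Int.gcd (c : ℤ) d = 1 → p.a c d * d - p.b c d * (c : ℤ) = 1
  two_le : 2 ≤ p.T
  y_pos : 0 < p.y
  mul_lt : p.T * p.y < 1
  lt : p.α < p.β
  len : (p.T * p.y / 2) ^ ((1:ℝ)/2) * (p.T * p.y / 2) ^ (-δ) ≤ p.β - p.α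

/-- The largest possible denominator of a cusp seen by the horocycle, `(T y)^(-1/2)`. -/
noncomputable def HoroParam.scale (p : HoroParam) : ℝ := 1 / √(p.T * p.y)

/-- The integers `d` for which the cusp `-d / c` is close to the segment. -/
noncomputable def HoroParam.nums (p : HoroParam) (c : ℕ) : Finset ℤ :=
  Finset.Icc ⌈-c * p.β - 1⌉ ⌊-c * p.α + 1⌋

/-- The normalised horocycle average of the lift of `f_T`. -/
noncomputable def HoroParam.avg (p : HoroParam) (h : ℝ → ℝ → ℂ) : ℂ :=
  ((p.T / (p.β - p.α) : ℝ) : ℂ) *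
    ∫ x in p.α..p.β, lift p.a p.b (fT p.T h) ((x : ℂ) + (p.y : ℂ) * Complex.I) 0

/-- The contribution of a single cusp `r` of denominator `c`, in the coordinate
`t = (x - x₀) / y` centred at the cusp. -/
noncomputable def cuspTerm (T y : ℝ) (h : ℝ → ℝ → ℂ) (c : ℕ) (r t : ℝ) : ℂ :=
  if T * y * c ^ 2 * (t ^ 2 + 1) ≤ 1 then
    h (r - 1 / (c ^ 2 * y) * (t / (t ^ 2 + 1))) (2 * Real.arctan t - Real.pi) else 0

lemma arg_add_I (t : ℝ) : Complex.arg ((t : ℂ) + Complex.I) = Real.pi / 2 - Real.arctan t := by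
  have h1 : (t : ℂ) + Complex.I = (√(1 + t ^ 2) : ℝ) *
      (Complex.cos ((Real.pi / 2 - Real.arctan t : ℝ)) +
        Complex.sin ((Real.pi / 2 - Real.arctan t : ℝ)) * Complex.I) := by
    rw [← Complex.ofReal_cos, ← Complex.ofReal_sin, Real.cos_pi_div_two_sub,
      Real.sin_pi_div_two_sub, Real.sin_arctan, Real.cos_arctan]
    have : (0 : ℝ) < √(1 + t ^ 2) := Real.sqrt_pos.mpr (by positivity)
    have : ((√(1 + t ^ 2) : ℝ) : ℂ) ≠ 0 := by exact_mod_cast this.ne'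
    push_cast
    field_simp
  rw [h1]
  apply Complex.arg_mul_cos_add_sin_mul_I (Real.sqrt_pos.mpr (by positivity))
  have h2 := Real.neg_pi_div_two_lt_arctan t
  have h3 := Real.arctan_lt_pi_div_two t
  have := Real.pi_pos
  constructor <;> linarith

lemma fT_eq_cuspTerm (T y x : ℝ) (hy : 0 < y) (h : ℝ → ℝ → ℂ) (c : ℕ) (hc : 1 ≤ c) (a b d : ℤ)
    (hdet : a * d - b * (c : ℤ) = 1) :
    fT T h (((a : ℂ) * ((x : ℂ) + (y : ℂ) * Complex.I) + (b : ℂ)) /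
        ((c : ℂ) * ((x : ℂ) + (y : ℂ) * Complex.I) + (d : ℂ)))
      (0 - 2 * Complex.arg ((c : ℂ) * ((x : ℂ) + (y : ℂ) * Complex.I) + (d : ℂ))) =
    cuspTerm T y h c ((a : ℝ) / c) ((x + (d : ℝ) / c) / y) := by
  have hcR : (0 : ℝ) < c := by exact_mod_cast hc
  obtain ⟨t, ht⟩ : ∃ t, t = (x + (d : ℝ) / c) / y := ⟨_, rfl⟩
  have hw : (c : ℂ) * ((x : ℂ) + (y : ℂ) * Complex.I) + (d : ℂ) =
      ((c * y : ℝ) : ℂ) * ((t : ℂ) + Complex.I) := by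
    rw [ht]
    have h1 : (c : ℂ) ≠ 0 := by exact_mod_cast hcR.ne'
    have h2 : (y : ℂ) ≠ 0 := by exact_mod_cast hy.ne'
    push_cast
    field_simp
    ring
  have htI : (t : ℂ) + Complex.I ≠ 0 := by
    intro h0
    have := congrArg Complex.im h0
    simp at this
  have hsq : ((t : ℂ) + Complex.I) * ((t : ℂ) - Complex.I) = ((t ^ 2 + 1 : ℝ) : ℂ) := by
    push_cast
    linear_combination - Complex.I_sq
  have hfrac : ((a : ℂ) * ((x : ℂ) + (y : ℂ) * Complex.I) + (b : ℂ)) /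
        ((c : ℂ) * ((x : ℂ) + (y : ℂ) * Complex.I) + (d : ℂ)) =
      ((a / c - 1 / (c ^ 2 * y) * (t / (t ^ 2 + 1)) : ℝ) : ℂ) +
        ((1 / (c ^ 2 * y * (t ^ 2 + 1)) : ℝ) : ℂ) * Complex.I := by
    have h1 : (c : ℂ) ≠ 0 := by exact_mod_cast hcR.ne'
    have h2 : (y : ℂ) ≠ 0 := by exact_mod_cast hy.ne'
    have h3 : ((t ^ 2 + 1 : ℝ) : ℂ) ≠ 0 := by
      have : t ^ 2 + 1 ≠ 0 := by positivity
      exact_mod_cast this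
    have hdet' : (a : ℂ) * d - b * c = 1 := by exact_mod_cast hdet
    have e1 : ((a / c - 1 / (c ^ 2 * y) * (t / (t ^ 2 + 1)) : ℝ) : ℂ) +
        ((1 / (c ^ 2 * y * (t ^ 2 + 1)) : ℝ) : ℂ) * Complex.I =
        (a : ℂ) / c - 1 / (c ^ 2 * y) * ((t - Complex.I) / ((t ^ 2 + 1 : ℝ) : ℂ)) := by
      have h3' : (t : ℂ) ^ 2 + 1 ≠ 0 := by simpa using h3
      push_cast
      field_simp
      ring
    rw [e1, ← hsq]
    have h4 : (t : ℂ) - Complex.I ≠ 0 := fun h0 => h3 (by rw [← hsq, h0, mul_zero])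
    have e2 : (a : ℂ) * ((x : ℂ) + (y : ℂ) * Complex.I) + (b : ℂ) =
        (a / c) * ((c * y : ℝ) * ((t : ℂ) + Complex.I)) - 1 / c := by
      rw [← hw]
      field_simp
      linear_combination (-1) * hdet'
    rw [e2, hw]
    push_cast
    field_simp
  have harg : Complex.arg ((c : ℂ) * ((x : ℂ) + (y : ℂ) * Complex.I) + (d : ℂ)) =
      Real.pi / 2 - Real.arctan t := by
    rw [hw, Complex.arg_real_mul _ (by positivity), arg_add_I]
  rw [harg, hfrac, ← ht, fT, cuspTerm]
  simp only [Complex.add_im, Complex.ofReal_im, Complex.mul_im, Complex.ofReal_re, Complex.I_im,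
    Complex.I_re, Complex.add_re, Complex.mul_re]
  have hiff : T ≤ 0 + (1 / (c ^ 2 * y * (t ^ 2 + 1)) * 1 + 0 * 0) ↔
      T * y * c ^ 2 * (t ^ 2 + 1) ≤ 1 := by
    rw [mul_one, mul_zero, zero_add, add_zero, le_div_iff₀ (by positivity)]
    ring_nf
  rw [if_congr hiff rfl rfl]
  congr 2 <;> ring

section Valid

variable {δ : ℝ} {p : HoroParam}

lemma HoroParam.Valid.T_pos (hp : p.Valid δ) : 0 < p.T := by linarith [hp.two_le]

lemma HoroParam.Valid.mul_pos (hp : p.Valid δ) : 0 < p.T * p.y := _root_.mul_pos hp.T_pos hp.y_pos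

lemma HoroParam.Valid.scale_pos (hp : p.Valid δ) : 0 < p.scale :=
  one_div_pos.mpr (Real.sqrt_pos.mpr hp.mul_pos)

lemma HoroParam.Valid.mul_scale_sq (hp : p.Valid δ) : p.T * p.y * p.scale ^ 2 = 1 := by
  have := hp.mul_pos
  rw [HoroParam.scale, div_pow, Real.sq_sqrt this.le, one_pow, mul_one_div,
    div_self this.ne']

lemma HoroParam.Valid.one_le_scale (hp : p.Valid δ) : 1 ≤ p.scale := by
  have h1 := hp.mul_scale_sq
  have h2 := hp.scale_pos
  have h3 := hp.mul_lt
  by_contra h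
  push Not at h
  nlinarith [hp.mul_pos]

lemma HoroParam.Valid.cond_iff (hp : p.Valid δ) (c : ℕ) (t : ℝ) :
    p.T * p.y * c ^ 2 * (t ^ 2 + 1) ≤ 1 ↔ c ^ 2 * (t ^ 2 + 1) ≤ p.scale ^ 2 := by
  rw [← hp.mul_scale_sq, mul_assoc (p.T * p.y), mul_le_mul_iff_right₀ hp.mul_pos]

lemma HoroParam.Valid.le_scale (hp : p.Valid δ) {c : ℕ} {t : ℝ}
    (h : p.T * p.y * c ^ 2 * (t ^ 2 + 1) ≤ 1) : (c : ℝ) ≤ p.scale := by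
  rw [hp.cond_iff] at h
  have := hp.scale_pos
  refine le_of_sq_le_sq ?_ this.le
  nlinarith [mul_nonneg (sq_nonneg (c : ℝ)) (sq_nonneg t)]

lemma HoroParam.Valid.abs_le_one (hp : p.Valid δ) {c : ℕ} {t : ℝ}
    (h : p.T * p.y * c ^ 2 * (t ^ 2 + 1) ≤ 1) : |c * (p.y * t)| ≤ 1 := by
  have h1 := hp.two_le
  have h2 := hp.mul_lt
  have h3 := hp.y_pos
  have h4 : p.y ≤ p.T := by nlinarith
  rw [← sq_le_one_iff_abs_le_one]
  have h5 : (c * (p.y * t)) ^ 2 ≤ p.T * p.y * c ^ 2 * t ^ 2 := by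
    calc _ = p.y * p.y * (c ^ 2 * t ^ 2) := by ring
      _ ≤ p.T * p.y * (c ^ 2 * t ^ 2) := by gcongr
      _ = _ := by ring
  have h6 : 0 ≤ p.T * p.y * (c : ℝ) ^ 2 := by have := hp.mul_pos; positivity
  nlinarith

lemma HoroParam.mem_nums (p : HoroParam) (c : ℕ) (d : ℤ) :
    d ∈ p.nums c ↔ -c * p.β - 1 ≤ (d : ℝ) ∧ (d : ℝ) ≤ -c * p.α + 1 := by
  rw [HoroParam.nums, Finset.mem_Icc, Int.ceil_le, Int.le_floor]

lemma HoroParam.card_nums_le (p : HoroParam) (c : ℕ) (h : p.α ≤ p.β) :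
    ((p.nums c).card : ℝ) ≤ c * (p.β - p.α) + 3 := by
  rw [HoroParam.nums, Int.card_Icc]
  have hc : (0 : ℝ) ≤ c := by positivity
  have h0 : 0 ≤ c * (p.β - p.α) := mul_nonneg hc (by linarith)
  have h1 : ((max (⌊-c * p.α + 1⌋ + 1 - ⌈-c * p.β - 1⌉) 0 : ℤ) : ℝ) ≤ c * (p.β - p.α) + 3 := by
    push_cast
    refine max_le ?_ (by linarith)
    have e1 := Int.floor_le (-c * p.α + 1)
    have e2 := Int.le_ceil (-c * p.β - 1)
    nlinarith
  rwa [← Int.toNat_eq_max] at h1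

/-- The cusp with denominator `c` and numerator `-d` contributes only if `d` lies in
`HoroParam.nums`. -/
lemma HoroParam.Valid.mem_nums_of_cond (hp : p.Valid δ) {c : ℕ} (hc : 1 ≤ c) {d : ℤ} {x : ℝ}
    (hx : x ∈ Set.Icc p.α p.β)
    (h : p.T * p.y * c ^ 2 * (((x + (d : ℝ) / c) / p.y) ^ 2 + 1) ≤ 1) : d ∈ p.nums c := by
  have h1 := hp.abs_le_one h
  have hcR : (0 : ℝ) < c := by exact_mod_cast hc
  have h2 : (c : ℝ) * (p.y * ((x + (d : ℝ) / c) / p.y)) = c * x + d := by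
    have := hp.y_pos
    field_simp
  rw [h2, abs_le] at h1
  rw [HoroParam.mem_nums]
  have h3 : c * p.α ≤ c * x := by gcongr; exact hx.1
  have h4 : c * x ≤ c * p.β := by gcongr; exact hx.2
  constructor <;> linarith

lemma HoroParam.Valid.lift_eq (hp : p.Valid δ) (h : ℝ → ℝ → ℂ) {x : ℝ}
    (hx : x ∈ Set.Icc p.α p.β) :
    lift p.a p.b (fT p.T h) ((x : ℂ) + (p.y : ℂ) * Complex.I) 0 =
      ∑ c ∈ Finset.Icc 1 ⌊p.scale⌋₊,
        ∑ d ∈ (p.nums c).filter (fun d : ℤ => Int.gcd (c : ℤ) d = 1),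
          cuspTerm p.T p.y h c ((p.a c d : ℝ) / c) ((x + (d : ℝ) / c) / p.y) := by
  have hterm : ∀ (c : ℕ) (d : ℤ), (if 1 ≤ c ∧ Int.gcd (c : ℤ) d = 1 then
      fT p.T h (((p.a c d : ℂ) * ((x : ℂ) + (p.y : ℂ) * Complex.I) + (p.b c d : ℂ)) /
        ((c : ℂ) * ((x : ℂ) + (p.y : ℂ) * Complex.I) + (d : ℂ)))
        (0 - 2 * Complex.arg ((c : ℂ) * ((x : ℂ) + (p.y : ℂ) * Complex.I) + (d : ℂ)))
      else 0) = if 1 ≤ c ∧ Int.gcd (c : ℤ) d = 1 then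
        cuspTerm p.T p.y h c ((p.a c d : ℝ) / c) ((x + (d : ℝ) / c) / p.y) else 0 := by
    intro c d
    split_ifs with hcd
    · exact fT_eq_cuspTerm _ _ _ hp.y_pos _ _ hcd.1 _ _ _ (hp.det c d hcd.1 hcd.2)
    · rfl
  have h0 : fT p.T h ((x : ℂ) + (p.y : ℂ) * Complex.I) 0 = 0 := by
    rw [fT, if_neg]
    simp only [Complex.add_im, Complex.ofReal_im, Complex.mul_im, Complex.ofReal_re, Complex.I_im,
      Complex.I_re]
    have := hp.two_le
    have := hp.mul_lt
    have := hp.y_pos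
    nlinarith
  rw [lift, h0, zero_add]
  simp_rw [hterm]
  rw [tsum_eq_sum (s := Finset.Icc 1 ⌊p.scale⌋₊)]
  · refine Finset.sum_congr rfl fun c hc => ?_
    have hc1 := (Finset.mem_Icc.mp hc).1
    rw [tsum_eq_sum (s := p.nums c), Finset.sum_filter]
    · simp [hc1]
    · intro d hd
      split_ifs with hcd
      · rw [cuspTerm, if_neg]
        exact fun hcon => hd (hp.mem_nums_of_cond hc1 hx hcon)
      · rfl
  · intro c hc
    refine (tsum_congr fun d => ?_).trans tsum_zero
    split_ifs with hcd
    · rw [cuspTerm, if_neg]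
      exact fun hcon => hc (Finset.mem_Icc.mpr ⟨hcd.1, Nat.le_floor (hp.le_scale hcon)⟩)
    · rfl

end Valid

/-- Bounded continuous functions of two real variables. -/
structure IsBddCont (h : ℝ → ℝ → ℂ) : Prop where
  cont : Continuous (Function.uncurry h)
  bdd : ∃ M : ℝ, ∀ x θ, ‖h x θ‖ ≤ M

lemma measurableSet_cond (T y : ℝ) (c : ℕ) :
    MeasurableSet {t : ℝ | T * y * c ^ 2 * (t ^ 2 + 1) ≤ 1} :=
  measurableSet_le (by fun_prop) measurable_const

lemma measurable_cuspTerm (T y : ℝ) {h : ℝ → ℝ → ℂ} (hh : Continuous (Function.uncurry h)) (c : ℕ)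
    (r : ℝ) : Measurable (cuspTerm T y h c r) := by
  refine Measurable.ite (measurableSet_cond T y c) ?_ measurable_const
  have h1 : Continuous fun t : ℝ => t / (t ^ 2 + 1) :=
    Continuous.div (by fun_prop) (by fun_prop) fun t => by positivity
  have h2 : Continuous fun t : ℝ =>
      (r - 1 / (c ^ 2 * y) * (t / (t ^ 2 + 1)), 2 * Real.arctan t - Real.pi) := by fun_prop
  exact (hh.comp h2).measurable

lemma norm_cuspTerm_le (T y : ℝ) {h : ℝ → ℝ → ℂ} {M : ℝ} (hM : ∀ x θ, ‖h x θ‖ ≤ M)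
    (c : ℕ) (r t : ℝ) :
    ‖cuspTerm T y h c r t‖ ≤ M * {t : ℝ | T * y * c ^ 2 * (t ^ 2 + 1) ≤ 1}.indicator 1 t := by
  rw [cuspTerm]
  by_cases hc : T * y * c ^ 2 * (t ^ 2 + 1) ≤ 1
  · simp [hc, hM]
  · simp [hc]

lemma intervalIntegrable_cuspTerm (T y : ℝ) {h : ℝ → ℝ → ℂ} (hh : IsBddCont h) (c : ℕ)
    (r s α β : ℝ) :
    IntervalIntegrable (fun x => cuspTerm T y h c r ((x + s) / y)) volume α β := by
  obtain ⟨M, hM⟩ := hh.bdd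
  have hM0 : 0 ≤ M := (norm_nonneg _).trans (hM 0 0)
  refine (intervalIntegrable_const (c := M)).mono_fun
    ((measurable_cuspTerm T y hh.cont c r).comp (by fun_prop)).aestronglyMeasurable
    (Filter.Eventually.of_forall fun x => ?_)
  refine (norm_cuspTerm_le T y hM c r _).trans ?_
  rw [Real.norm_of_nonneg hM0]
  exact mul_le_of_le_one_right hM0 (by
    rw [Set.indicator_apply]
    split_ifs <;> simp)

lemma HoroParam.Valid.avg_eq {δ : ℝ} {p : HoroParam} (hp : p.Valid δ) {h : ℝ → ℝ → ℂ}
    (hh : IsBddCont h) :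
    p.avg h = ((p.T / (p.β - p.α) : ℝ) : ℂ) * ∑ c ∈ Finset.Icc 1 ⌊p.scale⌋₊,
      ∑ d ∈ (p.nums c).filter (fun d : ℤ => Int.gcd (c : ℤ) d = 1),
        ∫ x in p.α..p.β, cuspTerm p.T p.y h c ((p.a c d : ℝ) / c) ((x + (d : ℝ) / c) / p.y) := by
  rw [HoroParam.avg]
  congr 1
  have h1 : ∀ x ∈ Set.uIcc p.α p.β,
      lift p.a p.b (fT p.T h) ((x : ℂ) + (p.y : ℂ) * Complex.I) 0 = _ := fun x hx =>
    hp.lift_eq h (by rwa [Set.uIcc_of_le hp.lt.le] at hx)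
  rw [intervalIntegral.integral_congr h1, intervalIntegral.integral_finsetSum]
  · refine Finset.sum_congr rfl fun c _ => ?_
    rw [intervalIntegral.integral_finsetSum]
    exact fun d _ => intervalIntegrable_cuspTerm _ _ hh _ _ _ _ _
  · intro c _
    have := IntervalIntegrable.sum ((p.nums c).filter (fun d : ℤ => Int.gcd (c : ℤ) d = 1))
      fun d _ => intervalIntegrable_cuspTerm p.T p.y hh c ((p.a c d : ℝ) / c) ((d : ℝ) / c) p.α p.β
    rwa [Finset.sum_fn] at this

lemma HoroParam.Valid.avg_add {δ : ℝ} {p : HoroParam} (hp : p.Valid δ) {h₁ h₂ : ℝ → ℝ → ℂ}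
    (hh₁ : IsBddCont h₁) (hh₂ : IsBddCont h₂) :
    p.avg (fun x θ => h₁ x θ + h₂ x θ) = p.avg h₁ + p.avg h₂ := by
  have h3 : IsBddCont fun x θ => h₁ x θ + h₂ x θ := by
    obtain ⟨M₁, hM₁⟩ := hh₁.bdd
    obtain ⟨M₂, hM₂⟩ := hh₂.bdd
    exact ⟨hh₁.cont.add hh₂.cont,
      M₁ + M₂, fun x θ => (norm_add_le _ _).trans (add_le_add (hM₁ x θ) (hM₂ x θ))⟩
  rw [hp.avg_eq hh₁, hp.avg_eq hh₂, hp.avg_eq h3, ← mul_add, ← Finset.sum_add_distrib]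
  congr 1
  refine Finset.sum_congr rfl fun c _ => ?_
  rw [← Finset.sum_add_distrib]
  refine Finset.sum_congr rfl fun d _ => ?_
  rw [← intervalIntegral.integral_add (intervalIntegrable_cuspTerm _ _ hh₁ _ _ _ _ _)
    (intervalIntegrable_cuspTerm _ _ hh₂ _ _ _ _ _)]
  congr 1
  ext x
  simp only [cuspTerm]
  split_ifs <;> simp

lemma HoroParam.Valid.avg_const_mul {δ : ℝ} {p : HoroParam} (hp : p.Valid δ) {h : ℝ → ℝ → ℂ}
    (hh : IsBddCont h) (s : ℂ) :
    p.avg (fun x θ => s * h x θ) = s * p.avg h := by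
  have h3 : IsBddCont fun x θ => s * h x θ := by
    obtain ⟨M, hM⟩ := hh.bdd
    refine ⟨continuous_const.mul hh.cont, ‖s‖ * M, fun x θ => ?_⟩
    rw [norm_mul]
    gcongr
    exact hM x θ
  rw [hp.avg_eq hh, hp.avg_eq h3, mul_left_comm]
  congr 1
  rw [Finset.mul_sum]
  refine Finset.sum_congr rfl fun c _ => ?_
  rw [Finset.mul_sum]
  refine Finset.sum_congr rfl fun d _ => ?_
  rw [← intervalIntegral.integral_const_mul]
  congr 1
  ext x
  simp only [cuspTerm]
  split_ifs <;> simp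

lemma isBddCont_torusChar (m n : ℤ) : IsBddCont (torusChar m n) :=
  ⟨continuous_torusChar m n, 1, fun x θ => (norm_torusChar m n x θ).le⟩

lemma torusChar_zero (x θ : ℝ) : torusChar 0 0 x θ = 1 := by simp [torusChar]

lemma HoroParam.Valid.norm_avg_le {δ : ℝ} {p : HoroParam} (hp : p.Valid δ) {h : ℝ → ℝ → ℂ}
    (hh : IsBddCont h) {M : ℝ} (hM : ∀ x θ, ‖h x θ‖ ≤ M) :
    ‖p.avg h‖ ≤ M * ‖p.avg (torusChar 0 0)‖ := by
  have hs : 0 ≤ p.T / (p.β - p.α) := div_nonneg hp.T_pos.le (by linarith [hp.lt])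
  set ind : ℕ → ℝ → ℝ := fun c t =>
    {t : ℝ | p.T * p.y * c ^ 2 * (t ^ 2 + 1) ≤ 1}.indicator 1 t with hind
  have hone : ∀ (c : ℕ) (r t : ℝ), cuspTerm p.T p.y (torusChar 0 0) c r t = (ind c t : ℂ) := by
    intro c r t
    simp only [cuspTerm, hind, torusChar_zero]
    by_cases hc : p.T * p.y * c ^ 2 * (t ^ 2 + 1) ≤ 1 <;> simp [hc]
  have hindi : ∀ (c : ℕ) (d : ℤ),
      IntervalIntegrable (fun x => ind c ((x + (d : ℝ) / c) / p.y)) volume p.α p.β := by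
    intro c d
    have := (intervalIntegrable_cuspTerm p.T p.y (isBddCont_torusChar 0 0) c 0 ((d : ℝ) / c)
      p.α p.β).norm
    simp only [hone, Complex.norm_real] at this
    refine this.congr ?_
    intro x _
    exact Real.norm_of_nonneg (Set.indicator_nonneg (by simp) _)
  have hind0 : ∀ (c : ℕ) (d : ℤ), 0 ≤ ∫ x in p.α..p.β, ind c ((x + (d : ℝ) / c) / p.y) :=
    fun c d => intervalIntegral.integral_nonneg hp.lt.le fun x _ =>
      Set.indicator_nonneg (by simp) _
  have e1 : p.avg (torusChar 0 0) = ((p.T / (p.β - p.α) * ∑ c ∈ Finset.Icc 1 ⌊p.scale⌋₊,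
      ∑ d ∈ (p.nums c).filter (fun d : ℤ => Int.gcd (c : ℤ) d = 1),
        ∫ x in p.α..p.β, ind c ((x + (d : ℝ) / c) / p.y) : ℝ) : ℂ) := by
    rw [hp.avg_eq (isBddCont_torusChar 0 0)]
    simp only [hone, intervalIntegral.integral_ofReal]
    push_cast
    rfl
  rw [e1, Complex.norm_real, Real.norm_of_nonneg (mul_nonneg hs (Finset.sum_nonneg fun c _ =>
    Finset.sum_nonneg fun d _ => hind0 c d)), hp.avg_eq hh, norm_mul, Complex.norm_real,
    Real.norm_of_nonneg hs, mul_left_comm, Finset.mul_sum]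
  gcongr
  refine (norm_sum_le _ _).trans (Finset.sum_le_sum fun c _ => ?_)
  rw [Finset.mul_sum]
  refine (norm_sum_le _ _).trans (Finset.sum_le_sum fun d _ => ?_)
  rw [← intervalIntegral.integral_const_mul]
  exact intervalIntegral.norm_integral_le_of_norm_le hp.lt.le
    (Filter.Eventually.of_forall fun x _ => norm_cuspTerm_le _ _ hM _ _ _) ((hindi c d).const_mul M)

/-- The size of the error made when counting the cusps that meet the segment. -/
noncomputable def HoroParam.err (p : HoroParam) : ℝ :=
  (1 + Real.log p.scale) ^ 2 / (p.scale * (p.β - p.α))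

lemma integral_cuspTerm_comp (T y : ℝ) (hy : 0 < y) (h : ℝ → ℝ → ℂ) (c : ℕ) (r s α β : ℝ) :
    ∫ x in α..β, cuspTerm T y h c r ((x + s) / y) =
      y * ∫ t in ((α + s) / y)..((β + s) / y), cuspTerm T y h c r t := by
  have := intervalIntegral.integral_comp_div_add (a := α) (b := β)
    (fun t => cuspTerm T y h c r t) hy.ne' (s / y)
  simp only [add_div]
  rw [this]
  rfl

lemma sum_one_div_floor_le {X : ℝ} (hX : 1 ≤ X) :
    ∑ c ∈ Finset.Icc 1 ⌊X⌋₊, (1 : ℝ) / c ≤ 1 + Real.log X := by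
  refine (sum_one_div_le _).trans ?_
  have h1 : (1 : ℝ) ≤ ⌊X⌋₊ := by exact_mod_cast Nat.le_floor (by simpa using hX)
  gcongr
  exact Nat.floor_le (by linarith)

section NonzeroFrequency

variable {δ : ℝ} {p : HoroParam}

lemma HoroParam.Valid.cond_iff_abs_le (hp : p.Valid δ) {c : ℕ} (hc : 1 ≤ c) (t : ℝ) :
    p.T * p.y * c ^ 2 * (t ^ 2 + 1) ≤ 1 ↔
      1 ≤ p.scale ^ 2 / c ^ 2 ∧ |t| ≤ √(p.scale ^ 2 / c ^ 2 - 1) := by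
  have hcR : (0 : ℝ) < c := by exact_mod_cast hc
  rw [hp.cond_iff, mul_comm, ← le_div_iff₀ (by positivity)]
  constructor
  · intro h
    refine ⟨by nlinarith [sq_nonneg t], Real.le_sqrt_of_sq_le ?_⟩
    rw [sq_abs]
    linarith
  · rintro ⟨h1, h2⟩
    have := Real.sq_sqrt (sub_nonneg.mpr h1)
    have h3 := pow_le_pow_left₀ (abs_nonneg t) h2 2
    rw [sq_abs, this] at h3
    linarith

lemma HoroParam.Valid.integral_cuspTerm_eq (hp : p.Valid δ) (h : ℝ → ℝ → ℂ) {c : ℕ} (hc : 1 ≤ c)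
    (hcC : (c : ℝ) ≤ p.scale) (r P Q : ℝ) (hPQ : P ≤ Q) :
    ∃ u v, -√(p.scale ^ 2 / c ^ 2 - 1) ≤ u ∧ u ≤ v ∧ v ≤ √(p.scale ^ 2 / c ^ 2 - 1) ∧
      ∫ t in P..Q, cuspTerm p.T p.y h c r t =
        ∫ t in u..v, h (r - 1 / (c ^ 2 * p.y) * (t / (t ^ 2 + 1))) (2 * Real.arctan t - Real.pi) := by
  have hcR : (0 : ℝ) < c := by exact_mod_cast hc
  set L := √(p.scale ^ 2 / c ^ 2 - 1) with hL
  have hL0 : 0 ≤ L := Real.sqrt_nonneg _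
  have h1 : 1 ≤ p.scale ^ 2 / c ^ 2 := by
    rw [le_div_iff₀ (by positivity), one_mul]
    gcongr
  set g : ℝ → ℂ := fun t =>
    h (r - 1 / (c ^ 2 * p.y) * (t / (t ^ 2 + 1))) (2 * Real.arctan t - Real.pi) with hg
  have h2 : cuspTerm p.T p.y h c r = (Set.Icc (-L) L).indicator g := by
    ext t
    rw [cuspTerm, Set.indicator_apply]
    refine if_congr ?_ rfl rfl
    rw [hp.cond_iff_abs_le hc, Set.mem_Icc, ← abs_le]
    exact and_iff_right h1
  have h3 : ∫ t in P..Q, cuspTerm p.T p.y h c r t =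
      ∫ t in Set.Ioc (max P (-L)) (min Q L), g t := by
    rw [intervalIntegral.integral_of_le hPQ, h2, setIntegral_indicator measurableSet_Icc,
      ← Set.Ioc_inter_Ioc]
    exact setIntegral_congr_set (Filter.EventuallyEq.inter (by rfl) Ioc_ae_eq_Icc.symm)
  rcases le_total (max P (-L)) (min Q L) with h4 | h4
  · exact ⟨_, _, le_max_right _ _, h4, min_le_right _ _, by
      rw [h3, intervalIntegral.integral_of_le h4]⟩
  · exact ⟨0, 0, by linarith, le_rfl, hL0, by
      rw [h3, Set.Ioc_eq_empty (not_lt.mpr h4), setIntegral_empty, intervalIntegral.integral_same]⟩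

lemma HoroParam.Valid.norm_avg_torusChar_le (hp : p.Valid δ) (m n : ℤ) {ε K : ℝ} (hε : 0 < ε)
    (hK : 0 ≤ K)
    (H : ∀ R : ℝ, 0 < R → ∀ r L P Q : ℝ, -L ≤ P → P ≤ Q → Q ≤ L →
      ‖∫ t in P..Q, torusChar m n (r - R * (t / (t ^ 2 + 1))) (2 * Real.arctan t - Real.pi)‖ ≤
        ε + K * (1 + L) * (1 + L ^ 2) / R) :
    ‖p.avg (torusChar m n)‖ ≤ (ε + 2 * K / p.T) * (1 + 3 * p.err) := by
  have hy := hp.y_pos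
  have hT := hp.T_pos
  have hC := hp.one_le_scale
  have hC0 := hp.scale_pos
  have hlen : 0 < p.β - p.α := sub_pos.mpr hp.lt
  set E := ε + 2 * K / p.T with hE
  have hE0 : 0 < E := by positivity
  have hint : ∀ c ∈ Finset.Icc 1 ⌊p.scale⌋₊, ∀ r s : ℝ,
      ‖∫ x in p.α..p.β, cuspTerm p.T p.y (torusChar m n) c r ((x + s) / p.y)‖ ≤
        p.y * E * p.scale * (1 / c) := by
    intro c hc r s
    obtain ⟨hc1, hc2⟩ := Finset.mem_Icc.mp hc
    have hcR : (0 : ℝ) < c := by exact_mod_cast hc1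
    have hcC : (c : ℝ) ≤ p.scale := (Nat.le_floor_iff hC0.le).mp hc2
    obtain ⟨u, v, hu, huv, hv, huveq⟩ := hp.integral_cuspTerm_eq (torusChar m n) hc1 hcC r
      ((p.α + s) / p.y) ((p.β + s) / p.y) (by have := hp.lt; gcongr)
    rw [integral_cuspTerm_comp _ _ hy, huveq, norm_mul, Complex.norm_real, Real.norm_of_nonneg hy.le]
    have h1 : 1 ≤ p.scale / c := by rwa [le_div_iff₀ hcR, one_mul]
    have h2 := H (1 / (c ^ 2 * p.y)) (by positivity) r _ u v hu huv hv
    set L := √(p.scale ^ 2 / c ^ 2 - 1) with hL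
    have hL2 : 1 + L ^ 2 = p.scale ^ 2 / c ^ 2 := by
      rw [hL, Real.sq_sqrt]
      · ring
      · rw [← div_pow]
        nlinarith
    have hL3 : L ≤ p.scale / c := by
      rw [hL, ← div_pow]
      exact Real.sqrt_le_iff.mpr ⟨by positivity, by linarith⟩
    have h3 : K * (1 + L) * (1 + L ^ 2) / (1 / (c ^ 2 * p.y)) = K * (1 + L) / p.T := by
      rw [hL2]
      have := hp.mul_scale_sq
      field_simp
      linear_combination (K * (1 + L)) * this
    rw [h3] at h2
    have h4 : ε + K * (1 + L) / p.T ≤ E * (p.scale / c) := by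
      have h5 : K * (1 + L) / p.T ≤ K * (2 * (p.scale / c)) / p.T := by
        gcongr
        linarith
      have h6 : ε ≤ ε * (p.scale / c) := le_mul_of_one_le_right hε.le h1
      calc _ ≤ ε * (p.scale / c) + K * (2 * (p.scale / c)) / p.T := by linarith
        _ = _ := by rw [hE]; ring
    calc _ ≤ p.y * (E * (p.scale / c)) := by gcongr; exact h2.trans h4
      _ = _ := by ring
  rw [hp.avg_eq (isBddCont_torusChar m n), norm_mul, Complex.norm_real,
    Real.norm_of_nonneg (by positivity)]
  have hsum : ‖∑ c ∈ Finset.Icc 1 ⌊p.scale⌋₊,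
      ∑ d ∈ (p.nums c).filter (fun d : ℤ => Int.gcd (c : ℤ) d = 1),
        ∫ x in p.α..p.β, cuspTerm p.T p.y (torusChar m n) c ((p.a c d : ℝ) / c)
          ((x + (d : ℝ) / c) / p.y)‖ ≤
      p.y * E * p.scale * (p.scale * (p.β - p.α) + 3 * (1 + Real.log p.scale)) := by
    calc _ ≤ ∑ c ∈ Finset.Icc 1 ⌊p.scale⌋₊,
          p.y * E * p.scale * ((p.β - p.α) + 3 * (1 / c)) := by
          refine (norm_sum_le _ _).trans (Finset.sum_le_sum fun c hc => ?_)
          have hcR : (0 : ℝ) < c := by exact_mod_cast (Finset.mem_Icc.mp hc).1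
          refine (norm_sum_le_of_le _ fun d _ => hint c hc _ _).trans ?_
          rw [Finset.sum_const, nsmul_eq_mul]
          have h1 : (((p.nums c).filter (fun d : ℤ => Int.gcd (c : ℤ) d = 1)).card : ℝ) ≤
              c * (p.β - p.α) + 3 :=
            le_trans (by exact_mod_cast Finset.card_filter_le _ _) (p.card_nums_le c hp.lt.le)
          calc _ ≤ (c * (p.β - p.α) + 3) * (p.y * E * p.scale * (1 / c)) := by gcongr
            _ = _ := by field_simp
      _ = p.y * E * p.scale * (⌊p.scale⌋₊ * (p.β - p.α) +
          3 * ∑ c ∈ Finset.Icc 1 ⌊p.scale⌋₊, (1 : ℝ) / c) := by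
          rw [← Finset.mul_sum, Finset.sum_add_distrib, ← Finset.mul_sum,
            Finset.sum_const, Nat.card_Icc, nsmul_eq_mul, Nat.add_sub_cancel]
      _ ≤ _ := by
          gcongr
          · exact Nat.floor_le hC0.le
          · exact sum_one_div_floor_le hC
  have hlog : 1 + Real.log p.scale ≤ (1 + Real.log p.scale) ^ 2 := by
    have := Real.log_nonneg hC
    nlinarith
  calc _ ≤ p.T / (p.β - p.α) *
        (p.y * E * p.scale * (p.scale * (p.β - p.α) + 3 * (1 + Real.log p.scale))) := by gcongr
    _ ≤ p.T / (p.β - p.α) *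
        (p.y * E * p.scale * (p.scale * (p.β - p.α) + 3 * (1 + Real.log p.scale) ^ 2)) := by gcongr
    _ = (p.T * p.y * p.scale ^ 2) * E * (1 + 3 * p.err) := by
        rw [HoroParam.err]
        field_simp
    _ = _ := by rw [hp.mul_scale_sq, one_mul]

end NonzeroFrequency

open Filter Topology in
/-- The limiting regime of the shrinking target problem. -/
noncomputable def HoroParam.regime (δ : ℝ) : Filter HoroParam :=
  comap (fun p => p.T) atTop ⊓ comap (fun p => p.T * p.y) (𝓝 0) ⊓ 𝓟 {p | p.Valid δ}

section Regime

open Filter Topology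

lemma HoroParam.eventually_valid (δ : ℝ) : ∀ᶠ p in HoroParam.regime δ, p.Valid δ :=
  mem_inf_of_right (mem_principal_self _)

lemma HoroParam.tendsto_T (δ : ℝ) : Tendsto (fun p : HoroParam => p.T) (regime δ) atTop :=
  tendsto_comap.mono_left (inf_le_left.trans inf_le_left)

lemma HoroParam.tendsto_mul (δ : ℝ) :
    Tendsto (fun p : HoroParam => p.T * p.y) (regime δ) (𝓝[>] 0) := by
  refine tendsto_nhdsWithin_iff.mpr ⟨tendsto_comap.mono_left (inf_le_left.trans inf_le_right), ?_⟩
  filter_upwards [eventually_valid δ] with p hp using hp.mul_pos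

lemma HoroParam.tendsto_scale (δ : ℝ) : Tendsto HoroParam.scale (regime δ) atTop := by
  have h1 : Tendsto (fun x : ℝ => √x) (𝓝[>] 0) (𝓝[>] 0) := by
    refine tendsto_nhdsWithin_iff.mpr ⟨?_, ?_⟩
    · have := (Real.continuous_sqrt.tendsto 0)
      rw [Real.sqrt_zero] at this
      exact this.mono_left nhdsWithin_le_nhds
    · filter_upwards [self_mem_nhdsWithin] with x hx using Real.sqrt_pos.mpr hx
  refine (tendsto_inv_nhdsGT_zero.comp (h1.comp (tendsto_mul δ))).congr fun p => ?_
  simp [scale]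

lemma HoroParam.Valid.le_scale_mul_len {δ : ℝ} {p : HoroParam} (hp : p.Valid δ) :
    (2 : ℝ) ^ (δ - 1 / 2) * p.scale ^ (2 * δ) ≤ p.scale * (p.β - p.α) := by
  have hC := hp.scale_pos
  have h1 : p.T * p.y / 2 = 2⁻¹ * p.scale ^ (-2 : ℝ) := by
    have := hp.mul_scale_sq
    rw [Real.rpow_neg hC.le, Real.rpow_two]
    field_simp
    linarith
  have h2 := hp.len
  rw [← Real.rpow_add (by have := hp.mul_pos; positivity), h1,
    Real.mul_rpow (by positivity) (by positivity), ← Real.rpow_mul hC.le,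
    Real.inv_rpow (by positivity), ← Real.rpow_neg (by positivity)] at h2
  have h3 := mul_le_mul_of_nonneg_left h2 hC.le
  refine le_trans (le_of_eq ?_) h3
  rw [mul_left_comm, show -((1 : ℝ) / 2 + -δ) = δ - 1 / 2 by ring]
  congr 1
  nth_rewrite 2 [← Real.rpow_one p.scale]
  rw [← Real.rpow_add hC]
  congr 1
  ring

lemma HoroParam.tendsto_err {δ : ℝ} (hδ : 0 < δ) : Tendsto HoroParam.err (regime δ) (𝓝 0) := by
  have h1 : Tendsto (fun x : ℝ => (1 + Real.log x) ^ 2 / ((2 : ℝ) ^ (δ - 1 / 2) * x ^ (2 * δ)))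
      atTop (𝓝 0) := by
    have h2 : Tendsto (fun x : ℝ => (1 + Real.log x) / x ^ δ) atTop (𝓝 0) := by
      have h3 : Tendsto (fun x : ℝ => 1 / x ^ δ) atTop (𝓝 0) :=
        (tendsto_rpow_atTop hδ).const_div_atTop 1
      have h4 : Tendsto (fun x : ℝ => Real.log x / x ^ δ) atTop (𝓝 0) :=
        (isLittleO_log_rpow_atTop hδ).tendsto_div_nhds_zero
      simpa [add_div] using h3.add h4
    have h5 := (h2.pow 2).const_mul ((2 : ℝ) ^ (δ - 1 / 2))⁻¹
    simp only [ne_eq, OfNat.ofNat_ne_zero, not_false_eq_true, zero_pow, mul_zero] at h5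
    refine h5.congr' ?_
    filter_upwards [eventually_gt_atTop 0] with x hx
    rw [two_mul, Real.rpow_add hx, div_pow, sq (x ^ δ)]
    field_simp
  refine squeeze_zero' ?_ ?_ (h1.comp (tendsto_scale δ))
  · filter_upwards [eventually_valid δ] with p hp
    have := hp.lt
    exact div_nonneg (sq_nonneg _) (mul_nonneg hp.scale_pos.le (by linarith))
  · filter_upwards [eventually_valid δ] with p hp
    have := hp.scale_pos
    exact div_le_div_of_nonneg_left (sq_nonneg _) (by positivity) hp.le_scale_mul_len

lemma HoroParam.tendsto_avg_of_ne_zero {δ : ℝ} (hδ : 0 < δ) (m n : ℤ) (hm : m ≠ 0) :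
    Tendsto (fun p : HoroParam => p.avg (torusChar m n)) (regime δ) (𝓝 0) := by
  rw [tendsto_zero_iff_norm_tendsto_zero]
  refine tendsto_order.mpr ⟨fun a ha => Eventually.of_forall fun p => ha.trans_le (norm_nonneg _),
    fun a ha => ?_⟩
  obtain ⟨K, hK, H⟩ := oscillatory_bound m n hm (a / 2) (by positivity)
  have h1 : Tendsto (fun p : HoroParam => (a / 2 + 2 * K / p.T) * (1 + 3 * p.err)) (regime δ)
      (𝓝 ((a / 2 + 0) * (1 + 3 * 0))) :=
    (((tendsto_T δ).const_div_atTop _).const_add _).mul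
      (((tendsto_err hδ).const_mul _).const_add _)
  filter_upwards [h1.eventually_lt_const (show _ < a by linarith), eventually_valid δ] with p h2 hp
  exact (hp.norm_avg_torusChar_le m n (by positivity) hK H).trans_lt h2

end Regime

/-- The boundary value `exp (i n (2 arctan t - π))` of a character of vanishing horizontal
frequency. -/
noncomputable def angleChar (n : ℤ) (t : ℝ) : ℂ := torusChar 0 n 0 (2 * Real.arctan t - Real.pi)

lemma norm_angleChar (n : ℤ) (t : ℝ) : ‖angleChar n t‖ = 1 := norm_torusChar _ _ _ _

lemma continuous_angleChar (n : ℤ) : Continuous (angleChar n) :=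
  (continuous_torusChar 0 n).comp (by fun_prop : Continuous fun t : ℝ =>
    ((0 : ℝ), 2 * Real.arctan t - Real.pi))

lemma angleChar_zero (t : ℝ) : angleChar 0 t = 1 := torusChar_zero _ _

lemma torusChar_zero_left (n : ℤ) (x θ : ℝ) : torusChar 0 n x θ = torusChar 0 n 0 θ := by
  simp [torusChar]

lemma hasDerivAt_angleChar (n : ℤ) (t : ℝ) :
    HasDerivAt (angleChar n) (angleChar n t * (2 * n * Complex.I * ((1 + t ^ 2)⁻¹ : ℝ))) t := by
  have h1 : HasDerivAt (fun t : ℝ => n * (2 * Real.arctan t - Real.pi))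
      (n * (2 * (1 / (1 + t ^ 2)))) t :=
    (((Real.hasDerivAt_arctan t).const_mul 2).sub_const _).const_mul _
  have h2 := (h1.ofReal_comp.mul_const Complex.I).cexp
  convert h2 using 1
  · ext s
    simp [angleChar, torusChar]
  · simp [angleChar, torusChar]
    ring

open Filter Topology in
lemma integral_angleChar (n : ℤ) :
    ∫ t : ℝ, (((1 + t ^ 2)⁻¹ : ℝ) : ℂ) * angleChar n t = if n = 0 then (Real.pi : ℂ) else 0 := by
  split_ifs with hn
  · subst hn
    simp_rw [angleChar_zero, mul_one]
    rw [integral_complex_ofReal, integral_univ_inv_one_add_sq]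
  · have hnC : (n : ℂ) ≠ 0 := by exact_mod_cast hn
    have hlim : ∀ (l : Filter ℝ) (s : ℝ), Tendsto Real.arctan l (𝓝 s) →
        Complex.exp ((n * (2 * s - Real.pi) : ℝ) * Complex.I) = 1 →
        Tendsto (fun t => angleChar n t / (2 * n * Complex.I)) l (𝓝 (1 / (2 * n * Complex.I))) := by
      intro l s hs h1
      refine Tendsto.div_const ?_ _
      rw [← h1]
      have h2 : Continuous fun u : ℝ => Complex.exp ((n * (2 * u - Real.pi) : ℝ) * Complex.I) := by
        fun_prop
      refine ((h2.tendsto s).comp hs).congr fun t => ?_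
      simp [angleChar, torusChar]
    have hder : ∀ t, HasDerivAt (fun t => angleChar n t / (2 * n * Complex.I))
        ((((1 + t ^ 2)⁻¹ : ℝ) : ℂ) * angleChar n t) t := by
      intro t
      refine ((hasDerivAt_angleChar n t).div_const (2 * n * Complex.I)).congr_deriv ?_
      rw [div_eq_iff (by simp [hnC, Complex.I_ne_zero])]
      ring
    have hint : Integrable fun t => (((1 + t ^ 2)⁻¹ : ℝ) : ℂ) * angleChar n t := by
      refine Integrable.mono' integrable_inv_one_add_sq
        (Continuous.aestronglyMeasurable ?_) (Eventually.of_forall fun t => ?_)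
      · have h1 : Continuous fun t : ℝ => (1 + t ^ 2)⁻¹ :=
          Continuous.inv₀ (by fun_prop) fun t => by positivity
        exact (Complex.continuous_ofReal.comp h1).mul (continuous_angleChar n)
      · rw [norm_mul, norm_angleChar, mul_one, Complex.norm_real,
          Real.norm_of_nonneg (by positivity)]
    have hbot := hlim atBot _ (Real.tendsto_arctan_atBot.mono_right nhdsWithin_le_nhds) (by
      rw [show ((n * (2 * -(Real.pi / 2) - Real.pi) : ℝ) : ℂ) * Complex.I =
        ((-n : ℤ) : ℂ) * (2 * Real.pi * Complex.I) by push_cast; ring]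
      exact Complex.exp_int_mul_two_pi_mul_I _)
    have htop := hlim atTop _ (Real.tendsto_arctan_atTop.mono_right nhdsWithin_le_nhds) (by
      rw [show (n * (2 * (Real.pi / 2) - Real.pi) : ℝ) = 0 by ring]
      simp)
    rw [integral_of_hasDerivAt_of_tendsto hder hint hbot htop, sub_self]

open Filter Topology in
lemma tendsto_integral_totientSum (n : ℤ) :
    Tendsto (fun X : ℝ => ∫ t : ℝ, ((totientSum (X / √(t ^ 2 + 1)) / X ^ 2 : ℝ) : ℂ) * angleChar n t)
      atTop (𝓝 (if n = 0 then (3 / Real.pi : ℂ) else 0)) := by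
  have hlim : (if n = 0 then (3 / Real.pi : ℂ) else 0) =
      ∫ t : ℝ, ((3 / Real.pi ^ 2 * (1 + t ^ 2)⁻¹ : ℝ) : ℂ) * angleChar n t := by
    simp_rw [Complex.ofReal_mul (3 / Real.pi ^ 2), mul_assoc]
    rw [integral_const_mul, integral_angleChar]
    have : (Real.pi : ℂ) ≠ 0 := by exact_mod_cast Real.pi_ne_zero
    split_ifs
    · push_cast
      field_simp
    · simp
  rw [hlim]
  have hsq : ∀ t : ℝ, 0 < √(t ^ 2 + 1) := fun t => Real.sqrt_pos.mpr (by positivity)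
  have hmeas : Measurable totientSum :=
    (measurable_from_nat (f := fun N => ∑ c ∈ Finset.Icc 1 N, (Nat.totient c : ℝ))).comp
      Nat.measurable_floor
  refine tendsto_integral_filter_of_dominated_convergence (fun t => (1 + t ^ 2)⁻¹) ?_ ?_
    integrable_inv_one_add_sq ?_
  · refine Eventually.of_forall fun X => Measurable.aestronglyMeasurable ?_
    refine Measurable.mul ?_ (continuous_angleChar n).measurable
    refine Complex.measurable_ofReal.comp ((hmeas.comp ?_).div_const _)
    fun_prop
  · filter_upwards [eventually_gt_atTop 0] with X hX
    refine Eventually.of_forall fun t => ?_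
    have h1 := totientSum_le (X / √(t ^ 2 + 1)) (div_nonneg hX.le (hsq t).le)
    rw [norm_mul, norm_angleChar, mul_one, Complex.norm_real,
      Real.norm_of_nonneg (div_nonneg (totientSum_nonneg _) (sq_nonneg _)),
      div_le_iff₀ (by positivity)]
    refine h1.trans (le_of_eq ?_)
    rw [div_pow, Real.sq_sqrt (by positivity)]
    ring
  · refine Eventually.of_forall fun t => Tendsto.mul_const _ ?_
    refine (Complex.continuous_ofReal.tendsto _).comp ?_
    have h1 := (tendsto_totientSum_div.comp (tendsto_id.atTop_div_const (hsq t))).mul_const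
      ((1 + t ^ 2)⁻¹)
    refine h1.congr fun X => ?_
    simp only [Function.comp, id]
    rw [div_pow, Real.sq_sqrt (by positivity)]
    have : (t ^ 2 + 1) ≠ 0 := by positivity
    rcases eq_or_ne X 0 with rfl | hX
    · simp
    · field_simp
      ring

section ZeroFrequency

variable {δ : ℝ} {p : HoroParam}

lemma cuspTerm_torusChar_zero (T y : ℝ) (n : ℤ) (c : ℕ) (r t : ℝ) :
    cuspTerm T y (torusChar 0 n) c r t =
      {t : ℝ | T * y * c ^ 2 * (t ^ 2 + 1) ≤ 1}.indicator (angleChar n) t := by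
  rw [cuspTerm, Set.indicator_apply, torusChar_zero_left]
  rfl

lemma HoroParam.Valid.cond_eq_Icc (hp : p.Valid δ) {c : ℕ} (hc : 1 ≤ c)
    (hcC : (c : ℝ) ≤ p.scale) :
    {t : ℝ | p.T * p.y * c ^ 2 * (t ^ 2 + 1) ≤ 1} =
      Set.Icc (-√(p.scale ^ 2 / c ^ 2 - 1)) (√(p.scale ^ 2 / c ^ 2 - 1)) := by
  have hcR : (0 : ℝ) < c := by exact_mod_cast hc
  ext t
  rw [Set.mem_ofPred_eq, hp.cond_iff_abs_le hc, Set.mem_Icc, ← abs_le]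
  refine and_iff_right ?_
  rw [le_div_iff₀ (by positivity), one_mul]
  gcongr

lemma HoroParam.Valid.volume_cond_le (hp : p.Valid δ) {c : ℕ} (hc : 1 ≤ c)
    (hcC : (c : ℝ) ≤ p.scale) :
    volume.real {t : ℝ | p.T * p.y * c ^ 2 * (t ^ 2 + 1) ≤ 1} ≤ 2 * (p.scale / c) := by
  have hC := hp.scale_pos
  rw [hp.cond_eq_Icc hc hcC, Real.volume_real_Icc_of_le (by
    linarith [Real.sqrt_nonneg (p.scale ^ 2 / c ^ 2 - 1)])]
  have : √(p.scale ^ 2 / c ^ 2 - 1) ≤ p.scale / c := by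
    rw [← div_pow]
    exact Real.sqrt_le_iff.mpr ⟨by positivity, by linarith⟩
  linarith

lemma HoroParam.Valid.integrableOn_angleChar (hp : p.Valid δ) (n : ℤ) {c : ℕ} (hc : 1 ≤ c)
    (hcC : (c : ℝ) ≤ p.scale) :
    IntegrableOn (angleChar n) {t : ℝ | p.T * p.y * c ^ 2 * (t ^ 2 + 1) ≤ 1} := by
  rw [hp.cond_eq_Icc hc hcC]
  exact (continuous_angleChar n).integrableOn_Icc

/-- The cusps of denominator `c` together produce their expected contribution, up to an error
governed by the number of divisors of `c`. -/
lemma HoroParam.Valid.norm_sum_sub_le (hp : p.Valid δ) (n : ℤ) {c : ℕ} (hc : 1 ≤ c)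
    (hcC : (c : ℝ) ≤ p.scale) :
    ‖(∑ d ∈ (p.nums c).filter (fun d : ℤ => Int.gcd (c : ℤ) d = 1),
        ∫ x in p.α..p.β, cuspTerm p.T p.y (torusChar 0 n) c ((p.a c d : ℝ) / c)
          ((x + (d : ℝ) / c) / p.y)) -
      ((p.y * (p.β - p.α) * Nat.totient c : ℝ) : ℂ) *
        ∫ t in {t : ℝ | p.T * p.y * c ^ 2 * (t ^ 2 + 1) ≤ 1}, angleChar n t‖ ≤
      2 * p.y * p.scale * (c.divisors.card / c) := by
  have hcR : (0 : ℝ) < c := by exact_mod_cast hc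
  have hy := hp.y_pos
  set S := {t : ℝ | p.T * p.y * c ^ 2 * (t ^ 2 + 1) ≤ 1} with hS
  have hSm : MeasurableSet S := measurableSet_cond _ _ _
  have hSfin : volume S ≠ ⊤ := by
    rw [hS, hp.cond_eq_Icc hc hcC]
    exact measure_Icc_lt_top.ne
  set D := (p.nums c).filter (fun d : ℤ => Int.gcd (c : ℤ) d = 1) with hD
  set J : ℤ → Set ℝ := fun d => Set.Ioc ((p.α + (d : ℝ) / c) / p.y) ((p.β + (d : ℝ) / c) / p.y)
    with hJ
  have hA := hp.integrableOn_angleChar n hc hcC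
  rw [← hS] at hA
  have hterm : ∀ d : ℤ, ∫ x in p.α..p.β, cuspTerm p.T p.y (torusChar 0 n) c ((p.a c d : ℝ) / c)
      ((x + (d : ℝ) / c) / p.y) = p.y * ∫ t in S, (J d).indicator (angleChar n) t := by
    intro d
    rw [integral_cuspTerm_comp _ _ hy, intervalIntegral.integral_of_le
      (by have := hp.lt; gcongr)]
    simp_rw [cuspTerm_torusChar_zero]
    rw [setIntegral_indicator hSm, setIntegral_indicator measurableSet_Ioc, Set.inter_comm]
  have hmem : ∀ (d : ℤ) (t : ℝ), t ∈ J d ↔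
      d ∈ Finset.Ico ⌈c * (p.y * t - p.β)⌉ ⌈c * (p.y * t - p.α)⌉ := by
    intro d t
    rw [Finset.mem_Ico, Int.ceil_le, Int.lt_ceil, hJ, Set.mem_Ioc, and_comm, div_lt_iff₀ hy,
      le_div_iff₀ hy, ← sub_le_iff_le_add', ← lt_sub_iff_add_lt', div_lt_iff₀ hcR, le_div_iff₀ hcR]
    ring_nf
  have hpt : ∀ t ∈ S, ‖∑ d ∈ D, (J d).indicator (angleChar n) t -
      (((p.β - p.α) * Nat.totient c : ℝ) : ℂ) * angleChar n t‖ ≤ c.divisors.card := by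
    intro t ht
    have h1 := hp.abs_le_one ht
    rw [abs_le] at h1
    have h2 : ∑ d ∈ D, (J d).indicator (angleChar n) t =
        (((Finset.Ico ⌈c * (p.y * t - p.β)⌉ ⌈c * (p.y * t - p.α)⌉).filter
          (fun d : ℤ => Int.gcd (c : ℤ) d = 1)).card : ℂ) * angleChar n t := by
      simp_rw [Set.indicator_apply]
      rw [← Finset.sum_filter, Finset.sum_const, nsmul_eq_mul]
      congr 3
      ext d
      simp only [Finset.mem_filter, hD, hmem]
      constructor
      · exact fun h => ⟨h.2, h.1.2⟩
      · rintro ⟨h3, h4⟩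
        refine ⟨⟨?_, h4⟩, h3⟩
        rw [Finset.mem_Ico, Int.ceil_le, Int.lt_ceil] at h3
        rw [HoroParam.mem_nums]
        constructor <;> linarith
    have h3 := card_coprime_Ico c hc (c * (p.y * t - p.β)) (c * (p.y * t - p.α)) (by
      have := hp.lt
      gcongr)
    rw [h2, ← sub_mul, norm_mul, norm_angleChar, mul_one]
    refine le_trans (le_of_eq ?_) h3
    rw [← Real.norm_eq_abs, ← Complex.norm_real]
    congr 1
    push_cast
    have : (c : ℂ) ≠ 0 := by exact_mod_cast hcR.ne'
    field_simp
    ring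
  have hJint : ∀ d ∈ D, Integrable ((J d).indicator (angleChar n)) (volume.restrict S) :=
    fun d _ => hA.indicator measurableSet_Ioc
  simp_rw [hterm]
  rw [← Finset.mul_sum, ← integral_finsetSum _ hJint, mul_assoc p.y, Complex.ofReal_mul p.y,
    mul_assoc (p.y : ℂ), ← mul_sub, ← integral_const_mul,
    ← integral_sub (integrable_finsetSum _ hJint) (hA.const_mul _), norm_mul, Complex.norm_real,
    Real.norm_of_nonneg hy.le]
  have h5 := norm_setIntegral_le_of_norm_le_const hSfin.lt_top hpt
  calc _ ≤ p.y * (c.divisors.card * volume.real S) := by gcongr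
    _ ≤ p.y * (c.divisors.card * (2 * (p.scale / c))) := by
        gcongr
        exact hp.volume_cond_le hc hcC
    _ = _ := by ring

lemma HoroParam.Valid.sum_totient_indicator (hp : p.Valid δ) (t : ℝ) :
    ∑ c ∈ Finset.Icc 1 ⌊p.scale⌋₊, (Nat.totient c : ℝ) *
      {t : ℝ | p.T * p.y * c ^ 2 * (t ^ 2 + 1) ≤ 1}.indicator 1 t =
      totientSum (p.scale / √(t ^ 2 + 1)) := by
  have hC := hp.scale_pos
  have hs : 0 < √(t ^ 2 + 1) := Real.sqrt_pos.mpr (by positivity)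
  have hs1 : 1 ≤ √(t ^ 2 + 1) := Real.one_le_sqrt.mpr (by nlinarith [sq_nonneg t])
  have h1 : ∀ c : ℕ, p.T * p.y * c ^ 2 * (t ^ 2 + 1) ≤ 1 ↔ c ≤ ⌊p.scale / √(t ^ 2 + 1)⌋₊ := by
    intro c
    rw [hp.cond_iff, Nat.le_floor_iff (by positivity), le_div_iff₀ hs,
      ← pow_le_pow_iff_left₀ (by positivity) hC.le two_ne_zero, mul_pow,
      Real.sq_sqrt (by positivity)]
  simp_rw [Set.indicator_apply, Set.mem_ofPred_eq, h1, Pi.one_apply, mul_ite, mul_one, mul_zero]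
  rw [← Finset.sum_filter, totientSum]
  congr 1
  ext c
  simp only [Finset.mem_filter, Finset.mem_Icc]
  have h2 : ⌊p.scale / √(t ^ 2 + 1)⌋₊ ≤ ⌊p.scale⌋₊ := Nat.floor_mono (div_le_self hC.le hs1)
  constructor
  · rintro ⟨⟨h3, _⟩, h4⟩
    exact ⟨h3, h4⟩
  · rintro ⟨h3, h4⟩
    exact ⟨⟨h3, h4.trans h2⟩, h4⟩

lemma HoroParam.Valid.norm_avg_sub_le (hp : p.Valid δ) (n : ℤ) :
    ‖p.avg (torusChar 0 n) - ∫ t : ℝ, ((totientSum (p.scale / √(t ^ 2 + 1)) / p.scale ^ 2 : ℝ) : ℂ) *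
      angleChar n t‖ ≤ 2 * p.err := by
  have hy := hp.y_pos
  have hT := hp.T_pos
  have hC := hp.one_le_scale
  have hC0 := hp.scale_pos
  have hlen : 0 < p.β - p.α := sub_pos.mpr hp.lt
  have hlenC : ((p.β - p.α : ℝ) : ℂ) ≠ 0 := by exact_mod_cast hlen.ne'
  set S : ℕ → Set ℝ := fun c => {t : ℝ | p.T * p.y * c ^ 2 * (t ^ 2 + 1) ≤ 1} with hS
  have hcond : ∀ c ∈ Finset.Icc 1 ⌊p.scale⌋₊, 1 ≤ c ∧ (c : ℝ) ≤ p.scale := fun c hc =>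
    ⟨(Finset.mem_Icc.mp hc).1, (Nat.le_floor_iff hC0.le).mp (Finset.mem_Icc.mp hc).2⟩
  have hmain : ∫ t : ℝ, ((totientSum (p.scale / √(t ^ 2 + 1)) / p.scale ^ 2 : ℝ) : ℂ) *
      angleChar n t = ((p.T / (p.β - p.α) : ℝ) : ℂ) * ∑ c ∈ Finset.Icc 1 ⌊p.scale⌋₊,
        ((p.y * (p.β - p.α) * Nat.totient c : ℝ) : ℂ) * ∫ t in S c, angleChar n t := by
    have h1 : 1 / p.scale ^ 2 = p.T * p.y := by
      rw [← hp.mul_scale_sq]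
      field_simp
    have h2 : ∀ t : ℝ, ((totientSum (p.scale / √(t ^ 2 + 1)) / p.scale ^ 2 : ℝ) : ℂ) *
        angleChar n t = ∑ c ∈ Finset.Icc 1 ⌊p.scale⌋₊,
          ((p.T * p.y * Nat.totient c : ℝ) : ℂ) * (S c).indicator (angleChar n) t := by
      intro t
      rw [div_eq_mul_one_div, h1, ← hp.sum_totient_indicator, Finset.sum_mul, Complex.ofReal_sum,
        Finset.sum_mul]
      refine Finset.sum_congr rfl fun c _ => ?_
      by_cases ht : t ∈ S c
      · rw [Set.indicator_of_mem ht, Set.indicator_of_mem ht]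
        push_cast
        simp only [Pi.one_apply]
        push_cast
        ring
      · rw [Set.indicator_of_notMem ht, Set.indicator_of_notMem ht]
        simp
    simp_rw [h2]
    rw [integral_finsetSum, Finset.mul_sum]
    · refine Finset.sum_congr rfl fun c _ => ?_
      rw [integral_const_mul, integral_indicator (measurableSet_cond _ _ _)]
      push_cast at hlenC ⊢
      field_simp
      rfl
    · exact fun c hc => Integrable.const_mul ((integrable_indicator_iff
        (measurableSet_cond _ _ _)).mpr (hp.integrableOn_angleChar n (hcond c hc).1
          (hcond c hc).2)) _
  rw [hmain, hp.avg_eq (isBddCont_torusChar 0 n), ← mul_sub, ← Finset.sum_sub_distrib, norm_mul,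
    Complex.norm_real, Real.norm_of_nonneg (by positivity)]
  calc _ ≤ p.T / (p.β - p.α) * ∑ c ∈ Finset.Icc 1 ⌊p.scale⌋₊,
        2 * p.y * p.scale * ((c.divisors.card : ℝ) / c) := by
        gcongr
        exact norm_sum_le_of_le _ fun c hc => hp.norm_sum_sub_le n (hcond c hc).1 (hcond c hc).2
    _ ≤ p.T / (p.β - p.α) * (2 * p.y * p.scale * (1 + Real.log p.scale) ^ 2) := by
        rw [← Finset.mul_sum]
        gcongr
        refine (sum_card_divisors_div_le _).trans ?_
        gcongr
        exact sum_one_div_floor_le hC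
    _ = (p.T * p.y * p.scale ^ 2) * (2 * p.err) := by
        rw [HoroParam.err]
        field_simp
    _ = _ := by rw [hp.mul_scale_sq, one_mul]

open Filter Topology in
lemma HoroParam.tendsto_avg_zero {δ : ℝ} (hδ : 0 < δ) (n : ℤ) :
    Tendsto (fun p : HoroParam => p.avg (torusChar 0 n)) (regime δ)
      (𝓝 (if n = 0 then (3 / Real.pi : ℂ) else 0)) := by
  have h1 := (tendsto_integral_totientSum n).comp (tendsto_scale δ)
  have h2 : Tendsto (fun p : HoroParam => p.avg (torusChar 0 n) -
      ∫ t : ℝ, ((totientSum (p.scale / √(t ^ 2 + 1)) / p.scale ^ 2 : ℝ) : ℂ) * angleChar n t)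
      (regime δ) (𝓝 0) := by
    refine squeeze_zero_norm' ?_ (by simpa using (tendsto_err hδ).const_mul 2)
    filter_upwards [eventually_valid δ] with p hp using hp.norm_avg_sub_le n
  simpa using h2.add h1

end ZeroFrequency

/-- The expected value of the normalised horocycle averages. -/
noncomputable def cuspMean (h : ℝ → ℝ → ℂ) : ℂ :=
  ((3 / (2 * Real.pi ^ 2) : ℝ) : ℂ) * ∫ θ in (0:ℝ)..(2 * Real.pi), ∫ x in (0:ℝ)..1, h x θ

section CuspMean

lemma IsBddCont.intervalIntegrable_left {h : ℝ → ℝ → ℂ} (hh : IsBddCont h) (θ : ℝ) :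
    IntervalIntegrable (fun x => h x θ) volume 0 1 :=
  (hh.cont.comp (by fun_prop : Continuous fun x : ℝ => (x, θ))).intervalIntegrable _ _

lemma IsBddCont.intervalIntegrable_right {h : ℝ → ℝ → ℂ} (hh : IsBddCont h) :
    IntervalIntegrable (fun θ => ∫ x in (0:ℝ)..1, h x θ) volume 0 (2 * Real.pi) := by
  have h1 : Continuous (Function.uncurry fun θ x => h x θ) := hh.cont.comp continuous_swap
  exact (intervalIntegral.continuous_parametric_intervalIntegral_of_continuous' h1
    0 1).intervalIntegrable _ _

lemma cuspMean_add {h₁ h₂ : ℝ → ℝ → ℂ} (hh₁ : IsBddCont h₁) (hh₂ : IsBddCont h₂) :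
    cuspMean (fun x θ => h₁ x θ + h₂ x θ) = cuspMean h₁ + cuspMean h₂ := by
  simp_rw [cuspMean, fun θ => intervalIntegral.integral_add (hh₁.intervalIntegrable_left θ)
    (hh₂.intervalIntegrable_left θ)]
  rw [intervalIntegral.integral_add hh₁.intervalIntegrable_right hh₂.intervalIntegrable_right,
    mul_add]

lemma cuspMean_const_mul (h : ℝ → ℝ → ℂ) (s : ℂ) :
    cuspMean (fun x θ => s * h x θ) = s * cuspMean h := by
  simp_rw [cuspMean, intervalIntegral.integral_const_mul]
  ring

lemma norm_cuspMean_le {h : ℝ → ℝ → ℂ} {M : ℝ} (hM : ∀ x θ, ‖h x θ‖ ≤ M) : ‖cuspMean h‖ ≤ M := by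
  have hM0 : 0 ≤ M := (norm_nonneg _).trans (hM 0 0)
  have hpi := Real.pi_pos
  have h1 : ∀ θ : ℝ, ‖∫ x in (0:ℝ)..1, h x θ‖ ≤ M := fun θ => by
    simpa using intervalIntegral.norm_integral_le_of_norm_le_const
      (a := 0) (b := 1) (f := fun x => h x θ) fun x _ => hM x θ
  have h2 : ‖∫ θ in (0:ℝ)..(2 * Real.pi), ∫ x in (0:ℝ)..1, h x θ‖ ≤ M * (2 * Real.pi) := by
    have := intervalIntegral.norm_integral_le_of_norm_le_const
      (a := 0) (b := 2 * Real.pi) (f := fun θ => ∫ x in (0:ℝ)..1, h x θ) fun θ _ => h1 θ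
    rwa [sub_zero, abs_of_pos (by positivity)] at this
  rw [cuspMean, norm_mul, Complex.norm_real, Real.norm_of_nonneg (by positivity)]
  calc _ ≤ 3 / (2 * Real.pi ^ 2) * (M * (2 * Real.pi)) := by gcongr
    _ = 3 / Real.pi * M := by field_simp
    _ ≤ 1 * M := by
        gcongr
        rw [div_le_one hpi]
        exact Real.pi_gt_three.le
    _ = M := one_mul M

lemma cuspMean_torusChar (m n : ℤ) :
    cuspMean (torusChar m n) = if m = 0 ∧ n = 0 then (3 / Real.pi : ℂ) else 0 := by
  have hpi : (Real.pi : ℂ) ≠ 0 := by exact_mod_cast Real.pi_ne_zero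
  have h1 : ∀ x θ : ℝ, torusChar m n x θ =
      Complex.exp ((n * Complex.I) * θ) * Complex.exp ((2 * Real.pi * m * Complex.I) * x) := by
    intro x θ
    rw [torusChar, ← Complex.exp_add]
    congr 1
    push_cast
    ring
  simp_rw [cuspMean, h1, intervalIntegral.integral_const_mul]
  rw [intervalIntegral.integral_mul_const]
  by_cases hm : m = 0
  · by_cases hn : n = 0
    · simp only [hm, hn, Int.cast_zero, zero_mul, mul_zero, Complex.exp_zero, and_self, if_true,
        intervalIntegral.integral_const, sub_zero, Complex.real_smul]
      push_cast
      field_simp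
    · have hnC : (n : ℂ) * Complex.I ≠ 0 :=
        mul_ne_zero (by exact_mod_cast hn) Complex.I_ne_zero
      have h2 : Complex.exp (n * Complex.I * ((2 * Real.pi : ℝ) : ℂ)) = 1 := by
        rw [← Complex.exp_int_mul_two_pi_mul_I n]
        congr 1
        push_cast
        ring
      rw [integral_exp_mul_complex hnC, h2]
      simp [hn]
  · have hmC : 2 * Real.pi * m * Complex.I ≠ 0 :=
      mul_ne_zero (mul_ne_zero (mul_ne_zero two_ne_zero hpi) (by exact_mod_cast hm))
        Complex.I_ne_zero
    have h2 : Complex.exp (2 * Real.pi * m * Complex.I * ((1 : ℝ) : ℂ)) = 1 := by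
      rw [← Complex.exp_int_mul_two_pi_mul_I m]
      congr 1
      push_cast
      ring
    rw [integral_exp_mul_complex hmC, h2]
    simp [hm]

end CuspMean

section Torus

open Filter Topology

lemma HoroParam.tendsto_avg_torusChar {δ : ℝ} (hδ : 0 < δ) (m n : ℤ) :
    Tendsto (fun p : HoroParam => p.avg (torusChar m n)) (regime δ)
      (𝓝 (cuspMean (torusChar m n))) := by
  rw [cuspMean_torusChar]
  by_cases hm : m = 0
  · subst hm
    simpa using tendsto_avg_zero hδ n
  · simpa [hm] using tendsto_avg_of_ne_zero hδ m n hm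

/-- A continuous function on the two-dimensional torus as a doubly periodic function. -/
noncomputable def torusPull (H : C(UnitAddTorus (Fin 2), ℂ)) (x θ : ℝ) : ℂ :=
  H ![(x : UnitAddCircle), ((θ / (2 * Real.pi) : ℝ) : UnitAddCircle)]

lemma norm_torusPull_le (H : C(UnitAddTorus (Fin 2), ℂ)) (x θ : ℝ) : ‖torusPull H x θ‖ ≤ ‖H‖ :=
  H.norm_coe_le_norm _

lemma isBddCont_torusPull (H : C(UnitAddTorus (Fin 2), ℂ)) : IsBddCont (torusPull H) := by
  refine ⟨H.continuous.comp (continuous_pi fun i => ?_), ‖H‖, norm_torusPull_le H⟩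
  have h1 : Continuous fun x : ℝ => (x : UnitAddCircle) := AddCircle.continuous_mk' 1
  fin_cases i
  · exact h1.comp continuous_fst
  · exact h1.comp (continuous_snd.div_const _)

lemma torusPull_mFourier (N : Fin 2 → ℤ) :
    torusPull (UnitAddTorus.mFourier N) = torusChar (N 0) (N 1) := by
  ext x θ
  have hpi : (Real.pi : ℂ) ≠ 0 := by exact_mod_cast Real.pi_ne_zero
  simp only [torusPull, UnitAddTorus.mFourier, ContinuousMap.coe_mk, Fin.prod_univ_two,
    Matrix.cons_val_zero, Matrix.cons_val_one, fourier_coe_apply]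
  rw [torusChar, ← Complex.exp_add]
  congr 1
  push_cast
  field_simp

lemma exists_torusPull_eq (h : ℝ → ℝ → ℂ) (hc : Continuous (Function.uncurry h))
    (hper1 : ∀ x θ, h (x + 1) θ = h x θ) (hper2 : ∀ x θ, h x (θ + 2 * Real.pi) = h x θ) :
    ∃ H : C(UnitAddTorus (Fin 2), ℂ), torusPull H = h := by
  have hq : IsOpenQuotientMap
      (Pi.map fun (_ : Fin 2) (x : ℝ) => (x : UnitAddCircle)) :=
    IsOpenQuotientMap.piMap fun _ => QuotientAddGroup.isOpenQuotientMap_mk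
  let q : C(Fin 2 → ℝ, UnitAddTorus (Fin 2)) := ⟨_, hq.continuous⟩
  let g : C(Fin 2 → ℝ, ℂ) := ⟨fun v => h (v 0) (2 * Real.pi * v 1),
    hc.comp (by fun_prop : Continuous fun v : Fin 2 → ℝ => (v 0, 2 * Real.pi * v 1))⟩
  have hint : ∀ a b : ℝ, (a : UnitAddCircle) = b → ∃ k : ℤ, a = b + k := by
    intro a b hab
    obtain ⟨k, hk⟩ := AddSubgroup.mem_zmultiples_iff.mp (QuotientAddGroup.eq_iff_sub_mem.mp hab)
    refine ⟨k, ?_⟩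
    rw [zsmul_eq_mul, mul_one] at hk
    linarith
  have hfac : Function.FactorsThrough g q := by
    intro v w hvw
    obtain ⟨k, hk⟩ := hint _ _ (congrFun hvw 0)
    obtain ⟨l, hl⟩ := hint _ _ (congrFun hvw 1)
    have p1 : ∀ θ, Function.Periodic (fun x => h x θ) 1 := fun θ x => hper1 x θ
    have p2 : ∀ x, Function.Periodic (h x) (2 * Real.pi) := hper2
    have e1 := (p1 (2 * Real.pi * v 1)).int_mul k (w 0)
    have e2 := (p2 (w 0)).int_mul l (2 * Real.pi * w 1)
    change h (v 0) (2 * Real.pi * v 1) = h (w 0) (2 * Real.pi * w 1)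
    rw [← e2, hk]
    rw [mul_one] at e1
    refine e1.trans ?_
    rw [hl]
    congr 1
    ring
  refine ⟨hq.isQuotientMap.lift (f := q) g hfac, ?_⟩
  ext x θ
  have h1 := DFunLike.congr_fun (Topology.IsQuotientMap.lift_comp (f := q) hq.isQuotientMap g hfac)
    ![x, θ / (2 * Real.pi)]
  have hpi := Real.pi_pos
  have h2 : g ![x, θ / (2 * Real.pi)] = h x θ := by
    change h x (2 * Real.pi * (θ / (2 * Real.pi))) = h x θ
    congr 1
    field_simp
  rw [h2] at h1
  rw [← h1, torusPull, ContinuousMap.comp_apply]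
  congr 1
  ext i
  fin_cases i <;> rfl

/-- The functions on the torus whose horocycle averages converge to the expected value. -/
def convergentSubmodule (δ : ℝ) : Submodule ℂ C(UnitAddTorus (Fin 2), ℂ) where
  carrier := {H | Tendsto (fun p : HoroParam => p.avg (torusPull H)) (HoroParam.regime δ)
    (𝓝 (cuspMean (torusPull H)))}
  add_mem' := by
    intro F G hF hG
    have h1 : torusPull (F + G) = fun x θ => torusPull F x θ + torusPull G x θ := rfl
    rw [Set.mem_ofPred_eq, h1, cuspMean_add (isBddCont_torusPull F) (isBddCont_torusPull G)]
    refine (hF.add hG).congr' ?_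
    filter_upwards [HoroParam.eventually_valid δ] with p hp
    rw [hp.avg_add (isBddCont_torusPull F) (isBddCont_torusPull G)]
  zero_mem' := by
    have h1 : torusPull 0 = fun x θ => 0 * torusPull 0 x θ := by
      ext x θ
      simp [torusPull]
    rw [Set.mem_ofPred_eq, h1, cuspMean_const_mul, zero_mul]
    refine tendsto_const_nhds.congr' ?_
    filter_upwards [HoroParam.eventually_valid δ] with p hp
    rw [hp.avg_const_mul (isBddCont_torusPull 0), zero_mul]
  smul_mem' := by
    intro s F hF
    have h1 : torusPull (s • F) = fun x θ => s * torusPull F x θ := rfl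
    rw [Set.mem_ofPred_eq, h1, cuspMean_const_mul]
    refine (hF.const_mul s).congr' ?_
    filter_upwards [HoroParam.eventually_valid δ] with p hp
    rw [hp.avg_const_mul (isBddCont_torusPull F)]

lemma mem_convergentSubmodule {δ : ℝ} {H : C(UnitAddTorus (Fin 2), ℂ)} :
    H ∈ convergentSubmodule δ ↔ Tendsto (fun p : HoroParam => p.avg (torusPull H))
      (HoroParam.regime δ) (𝓝 (cuspMean (torusPull H))) := Iff.rfl

lemma isClosed_convergentSubmodule {δ : ℝ} (hδ : 0 < δ) :
    IsClosed (convergentSubmodule δ : Set C(UnitAddTorus (Fin 2), ℂ)) := by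
  refine isClosed_of_closure_subset fun H hH => ?_
  rw [SetLike.mem_coe, mem_convergentSubmodule, Metric.tendsto_nhds]
  intro ε hε
  obtain ⟨G, hG, hHG⟩ := Metric.mem_closure_iff.mp hH (ε / 4) (by positivity)
  have h1 : torusPull H = fun x θ => torusPull (H - G) x θ + torusPull G x θ := by
    ext x θ
    simp [torusPull]
  have hle : ‖H - G‖ ≤ ε / 4 := by
    rw [← dist_eq_norm]
    exact hHG.le
  have hmean : ‖cuspMean (torusPull (H - G))‖ ≤ ε / 4 :=
    (norm_cuspMean_le (norm_torusPull_le (H - G))).trans hle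
  have hone : ∀ᶠ p in HoroParam.regime δ, ‖p.avg (torusChar 0 0)‖ < 2 := by
    have h2 := (HoroParam.tendsto_avg_torusChar hδ 0 0).norm
    refine h2.eventually_lt_const ?_
    exact (norm_cuspMean_le fun x θ => (norm_torusChar 0 0 x θ).le).trans_lt one_lt_two
  filter_upwards [hone, HoroParam.eventually_valid δ,
    Metric.tendsto_nhds.mp (mem_convergentSubmodule.mp hG) (ε / 4) (by positivity)] with p h2 hp h3
  have h4 : ‖p.avg (torusPull (H - G))‖ ≤ ε / 4 * 2 := by
    refine (hp.norm_avg_le (isBddCont_torusPull _) (norm_torusPull_le _)).trans ?_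
    gcongr
  rw [h1, cuspMean_add (isBddCont_torusPull _) (isBddCont_torusPull _),
    hp.avg_add (isBddCont_torusPull _) (isBddCont_torusPull _), dist_eq_norm, add_sub_add_comm]
  rw [dist_eq_norm] at h3
  calc _ ≤ ‖p.avg (torusPull (H - G))‖ + ‖cuspMean (torusPull (H - G))‖ +
        ‖p.avg (torusPull G) - cuspMean (torusPull G)‖ :=
        (norm_add_le _ _).trans (add_le_add_left (norm_sub_le _ _) _)
    _ < ε := by linarith

/-- Equidistribution of horocycle segments in the shrinking cuspidal target. -/
theorem HoroParam.tendsto_avg {δ : ℝ} (hδ : 0 < δ) (h : ℝ → ℝ → ℂ)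
    (hc : Continuous (Function.uncurry h)) (hper1 : ∀ x θ, h (x + 1) θ = h x θ)
    (hper2 : ∀ x θ, h x (θ + 2 * Real.pi) = h x θ) :
    Tendsto (fun p : HoroParam => p.avg h) (regime δ) (𝓝 (cuspMean h)) := by
  obtain ⟨H, rfl⟩ := exists_torusPull_eq h hc hper1 hper2
  have h1 : Submodule.span ℂ (Set.range UnitAddTorus.mFourier) ≤ convergentSubmodule δ := by
    rw [Submodule.span_le]
    rintro _ ⟨N, rfl⟩
    rw [SetLike.mem_coe, mem_convergentSubmodule, torusPull_mFourier]
    exact tendsto_avg_torusChar hδ _ _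
  have h2 := Submodule.topologicalClosure_minimal _ h1 (isClosed_convergentSubmodule hδ)
  rw [UnitAddTorus.span_mFourier_closure_eq_top] at h2
  exact h2 Submodule.mem_top

end Torus

/-- Shrinking target horocycle equidistribution: non-effective main theorem,
for the modular group (where `B₁ = 2` and `μ(Γ\G) = 2π²/3`). -/
theorem stmt_7 (h : ℝ → ℝ → ℂ) (hsm : ContDiff ℝ (⊤ : ℕ∞) (Function.uncurry h))
    (hper1 : ∀ x θ, h (x + 1) θ = h x θ)
    (hper2 : ∀ x θ, h x (θ + 2 * Real.pi) = h x θ)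
    (δ : ℝ) (hδ0 : 0 < δ) (ε : ℝ) (hε : 0 < ε) :
    ∃ T₀ : ℝ, 2 ≤ T₀ ∧ ∃ r₀ : ℝ, 0 < r₀ ∧ r₀ < 1 ∧
      ∀ (a b : ℕ → ℤ → ℤ),
        (∀ (c : ℕ) (d : ℤ), 1 ≤ c → Int.gcd (c : ℤ) d = 1 →
          a c d * d - b c d * (c : ℤ) = 1) →
        ∀ T : ℝ, T₀ ≤ T → ∀ y : ℝ, 0 < y → T * y ≤ r₀ →
          ∀ α β : ℝ, α < β →
            max (T ^ (-(1:ℝ)/6)) ((T * y / 2) ^ ((1:ℝ)/2)) * (T * y / 2) ^ (-δ) ≤ β - α →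
            ‖((T / (β - α) : ℝ) : ℂ) *
                (∫ x in α..β, lift a b (fT T h) ((x : ℂ) + (y : ℂ) * Complex.I) 0) -
              ((3 / (2 * Real.pi ^ 2) : ℝ) : ℂ) *
                (∫ θ in (0:ℝ)..(2 * Real.pi), ∫ x in (0:ℝ)..1, h x θ)‖ ≤ ε := by
  have hlim := Metric.tendsto_nhds.mp
    (HoroParam.tendsto_avg hδ0 h hsm.continuous hper1 hper2) ε hε
  rw [HoroParam.regime, Filter.eventually_inf_principal,
    ((Filter.atTop_basis.comap _).inf (Metric.nhds_basis_ball.comap _)).eventually_iff] at hlim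
  obtain ⟨⟨T₁, r₁⟩, ⟨-, hr₁⟩, H⟩ := hlim
  refine ⟨max 2 T₁, le_max_left _ _, min (r₁ / 2) (1 / 2), by positivity,
    (min_le_right _ _).trans_lt (by norm_num), ?_⟩
  intro a b hab T hT y hy hTy α β hαβ hlen
  have hT2 : 2 ≤ T := (le_max_left _ _).trans hT
  have hTy0 : 0 < T * y := by positivity
  have h1 : T * y ≤ r₁ / 2 := hTy.trans (min_le_left _ _)
  have h2 : T * y ≤ 1 / 2 := hTy.trans (min_le_right _ _)
  have hvalid : HoroParam.Valid δ ⟨a, b, T, y, α, β⟩ :=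
    ⟨hab, hT2, hy, by linarith, hαβ,
      (mul_le_mul_of_nonneg_right (le_max_right _ _) (by positivity)).trans hlen⟩
  have hmem := H (x := ⟨a, b, T, y, α, β⟩) ⟨(le_max_right _ _).trans hT, by
    change dist (T * y) 0 < r₁
    rw [Real.dist_eq, sub_zero, abs_of_pos hTy0]
    linarith⟩ hvalid
  rw [dist_eq_norm] at hmem
  exact hmem.le
end
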